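/- arXiv:1810.10803 — 3 statements merged into one kernel-verified Lean document; each statement's English description precedes it below -/
import Mathlib

section
/- For non-negative integers a and b, for all but finitely many primes p the following congruence of rational numbers holds modulo p: the truncated multiple zeta value Z_p({2}^a, 3, {2}^b) is congruent to ((−1)^{a+b} · 2 · (a−b)/(a+1)) · C(2a+2b+3, 2b+2) · (B_{p−2a−2b−3}/(2a+2b+3)) modulo p, where C(n,k) denotes the binomial coefficient. -/
/-- `ZAux N ks a = ∑_{a ≤ n₁ < ⋯ < n_r ≤ N} ∏ᵢ 1/nᵢ^{kᵢ}` for `ks = (k₁,…,k_r)`. -/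
def ZAux (N : ℕ) : List ℕ → ℕ → ℚ
  | [], _ => 1
  | k :: ks, a => ∑ n ∈ Finset.Icc a N, ((n : ℚ) ^ k)⁻¹ * ZAux N ks (n + 1)

/-- Truncated multiple zeta value `Z_p(k₁,…,k_r) = ∑_{1 ≤ n₁ < ⋯ < n_r ≤ p-1} 1/(n₁^{k₁}⋯n_r^{k_r})`. -/
def Z (p : ℕ) (ks : List ℕ) : ℚ := ZAux (p - 1) ks 1

/-- `ZsAux N ks a = ∑_{a ≤ n₁ ≤ ⋯ ≤ n_r ≤ N} ∏ᵢ 1/nᵢ^{kᵢ}`. -/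
def ZsAux (N : ℕ) : List ℕ → ℕ → ℚ
  | [], _ => 1
  | k :: ks, a => ∑ n ∈ Finset.Icc a N, ((n : ℚ) ^ k)⁻¹ * ZsAux N ks n

/-- Truncated multiple zeta-star value. -/
def Zstar (p : ℕ) (ks : List ℕ) : ℚ := ZsAux (p - 1) ks 1

/-- `α ≡ β (mod p^e)` for rationals: the `p`-adic valuation of `α - β` is at least `e`,
expressed via the `p`-adic norm. -/
def congrMod (p e : ℕ) (α β : ℚ) : Prop := padicNorm p (α - β) ≤ (p : ℚ) ^ (-(e : ℤ))

/-- `gapIndex a b c [m₀, m₁, …, m_{2l}]` is the index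
`{c}^{m₀}, a, {c}^{m₁}, b, {c}^{m₂}, …, a, {c}^{m_{2l-1}}, b, {c}^{m_{2l}}`. -/
def gapIndex (a b c : ℕ) : List ℕ → List ℕ
  | [] => []
  | [m0] => List.replicate m0 c
  | m0 :: m1 :: rest =>
      List.replicate m0 c ++ a :: (List.replicate m1 c ++ b :: gapIndex a b c rest)

namespace TruncatedMZV

open Finset Polynomial

/-- The rational `q` is `p`-integral with residue class `z`. -/
def HasResidue (p : ℕ) (q : ℚ) (z : ZMod p) : Prop :=
  ∃ (m : ℤ) (d : ℕ), (d : ZMod p) ≠ 0 ∧ q * d = m ∧ z * d = m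

section Residue

variable {p : ℕ} [Fact p.Prime]

lemma HasResidue.intCast (m : ℤ) : HasResidue p m m := ⟨m, 1, by simp⟩

lemma HasResidue.natCast (m : ℕ) : HasResidue p m m := by
  simpa using HasResidue.intCast (p := p) m

lemma HasResidue.add {q r : ℚ} {y z : ZMod p} (hq : HasResidue p q y) (hr : HasResidue p r z) :
    HasResidue p (q + r) (y + z) := by
  obtain ⟨m, d, hd, h1, h2⟩ := hq
  obtain ⟨m', d', hd', h1', h2'⟩ := hr
  refine ⟨m * d' + m' * d, d * d', by push_cast; exact mul_ne_zero hd hd', ?_, ?_⟩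
  · push_cast
    rw [← h1, ← h1']
    ring
  · push_cast
    rw [← h2, ← h2']
    ring

lemma HasResidue.mul {q r : ℚ} {y z : ZMod p} (hq : HasResidue p q y) (hr : HasResidue p r z) :
    HasResidue p (q * r) (y * z) := by
  obtain ⟨m, d, hd, h1, h2⟩ := hq
  obtain ⟨m', d', hd', h1', h2'⟩ := hr
  refine ⟨m * m', d * d', by push_cast; exact mul_ne_zero hd hd', ?_, ?_⟩
  · push_cast
    rw [← h1, ← h1']
    ring
  · push_cast
    rw [← h2, ← h2']
    ring

lemma HasResidue.pow {q : ℚ} {z : ZMod p} (hq : HasResidue p q z) (k : ℕ) :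
    HasResidue p (q ^ k) (z ^ k) := by
  induction k with
  | zero => simpa using HasResidue.intCast (p := p) 1
  | succ k ih => simpa [pow_succ] using ih.mul hq

lemma HasResidue.inv_natCast {m : ℕ} (hm : (m : ZMod p) ≠ 0) :
    HasResidue p (m : ℚ)⁻¹ (m : ZMod p)⁻¹ := by
  have hm' : (m : ℚ) ≠ 0 := by
    rintro h
    apply hm
    rw [Nat.cast_eq_zero.mp h, Nat.cast_zero]
  exact ⟨1, m, hm, by simp [hm'], by simp [hm]⟩

lemma HasResidue.sum {ι : Type*} (s : Finset ι) {f : ι → ℚ} {g : ι → ZMod p}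
    (h : ∀ i ∈ s, HasResidue p (f i) (g i)) : HasResidue p (∑ i ∈ s, f i) (∑ i ∈ s, g i) := by
  classical
  induction s using Finset.induction_on with
  | empty => simpa using HasResidue.intCast (p := p) 0
  | insert a s ha ih =>
    rw [sum_insert ha, sum_insert ha]
    exact (h a (mem_insert_self a s)).add (ih fun i hi => h i (mem_insert_of_mem hi))

lemma HasResidue.unique {q : ℚ} {y z : ZMod p} (hy : HasResidue p q y) (hz : HasResidue p q z) :
    y = z := by
  obtain ⟨m, d, hd, h1, h2⟩ := hy
  obtain ⟨m', d', hd', h1', h2'⟩ := hz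
  have h : m * d' = m' * d := by
    have : (m * d' : ℚ) = m' * d := by
      rw [← h1, ← h1']
      ring
    exact_mod_cast this
  have h' : (m * d' : ZMod p) = m' * d := by exact_mod_cast congrArg (Int.cast : ℤ → ZMod p) h
  rw [← h2, ← h2'] at h'
  apply mul_right_cancel₀ (mul_ne_zero hd hd')
  linear_combination h'

lemma HasResidue.congrMod_one {q r : ℚ} {z : ZMod p} (hq : HasResidue p q z)
    (hr : HasResidue p r z) : congrMod p 1 q r := by
  obtain ⟨m, d, hd, h1, h2⟩ := hq
  obtain ⟨m', d', hd', h1', h2'⟩ := hr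
  have norm_eq_one : ∀ {e : ℕ}, (e : ZMod p) ≠ 0 → padicNorm p e = 1 := fun he =>
    (padicNorm.nat_eq_one_iff _).mpr fun h => he ((ZMod.natCast_eq_zero_iff _ _).mpr h)
  have hdvd : ((p ^ 1 : ℕ) : ℤ) ∣ m * d' - m' * d := by
    rw [pow_one, ← ZMod.intCast_zmod_eq_zero_iff_dvd]
    push_cast
    rw [← h2, ← h2']
    ring
  have hnorm := padicNorm.dvd_iff_norm_le.mp hdvd
  have hdiff : ((m * d' - m' * d : ℤ) : ℚ) = (q - r) * d * d' := by
    push_cast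
    rw [← h1, ← h1']
    ring
  rwa [hdiff, padicNorm.mul, padicNorm.mul, norm_eq_one hd, norm_eq_one hd', mul_one,
    mul_one] at hnorm

lemma natCast_ne_zero_of_lt {m : ℕ} (h0 : m ≠ 0) (hm : m < p) : (m : ZMod p) ≠ 0 := by
  rw [Ne, ZMod.natCast_eq_zero_iff]
  exact Nat.not_dvd_of_pos_of_lt (Nat.pos_of_ne_zero h0) hm

lemma natCast_factorial_ne_zero {m : ℕ} (hm : m < p) : (m.factorial : ZMod p) ≠ 0 := by
  rw [Ne, ZMod.natCast_eq_zero_iff, (Fact.out : p.Prime).dvd_factorial]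
  omega

lemma exists_hasResidue_bernoulli (i : ℕ) (hi : i + 1 < p) :
    ∃ z : ZMod p, HasResidue p (_root_.bernoulli i) z := by
  induction i using Nat.strong_induction_on with
  | _ i ih =>
    choose! g hg using ih
    rcases Nat.eq_zero_or_pos i with rfl | hpos
    · exact ⟨1, by simpa using HasResidue.intCast (p := p) 1⟩
    · have h := _root_.sum_bernoulli (i + 1)
      rw [sum_range_succ, if_neg (by omega)] at h
      have hne : ((i + 1 : ℕ) : ℚ) ≠ 0 := by positivity
      have key : _root_.bernoulli i = ((-1 : ℤ) : ℚ) * ((i + 1 : ℕ) : ℚ)⁻¹ *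
          ∑ k ∈ range i, (((i + 1).choose k : ℕ) : ℚ) * _root_.bernoulli k := by
        rw [Nat.choose_succ_self_right] at h
        field_simp
        push_cast at h ⊢
        linarith
      rw [key]
      exact ⟨_, ((HasResidue.intCast _).mul
        (HasResidue.inv_natCast (natCast_ne_zero_of_lt (by omega) hi))).mul
        (HasResidue.sum _ fun k hk => (HasResidue.natCast _).mul
          (hg k (mem_range.mp hk) (by have := mem_range.mp hk; omega)))⟩

end Residue

section GeneratingPolynomial

/-- The polynomial `∏_{lo ≤ j < hi} (1 - X / j²)` over `𝔽_p`. -/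
noncomputable def genPoly (p lo hi : ℕ) : (ZMod p)[X] :=
  ∏ j ∈ Ico lo hi, (1 - C (((j : ZMod p) ^ 2)⁻¹) * X)

lemma genPoly_self (p m : ℕ) : genPoly p m m = 1 := by simp [genPoly]

lemma genPoly_mul_genPoly (p : ℕ) {lo mid hi : ℕ} (h : lo ≤ mid) (h' : mid ≤ hi) :
    genPoly p lo mid * genPoly p mid hi = genPoly p lo hi :=
  prod_Ico_consecutive _ h h'

variable {p : ℕ} [Fact p.Prime]

lemma genPoly_succ_bot {lo hi : ℕ} (h : lo < hi) :
    genPoly p lo hi = (1 - C (((lo : ZMod p) ^ 2)⁻¹) * X) * genPoly p (lo + 1) hi :=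
  prod_eq_prod_Ico_succ_bot h _

lemma genPoly_succ_top {lo hi : ℕ} (h : lo ≤ hi) :
    genPoly p lo (hi + 1) = genPoly p lo hi * (1 - C (((hi : ZMod p) ^ 2)⁻¹) * X) :=
  prod_Ico_succ_top h _

lemma natDegree_genPoly_le (lo hi : ℕ) : (genPoly p lo hi).natDegree ≤ hi - lo := by
  refine (natDegree_prod_le _ _).trans ?_
  refine (sum_le_card_nsmul _ _ 1 fun j _ => ?_).trans (by simp)
  compute_degree

lemma coeff_zero_genPoly (lo hi : ℕ) : (genPoly p lo hi).coeff 0 = 1 := by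
  rw [coeff_zero_eq_eval_zero, genPoly, eval_prod]
  exact prod_eq_one fun j _ => by simp

lemma coeff_succ_genPoly (a lo hi : ℕ) :
    (genPoly p lo hi).coeff (a + 1) =
      -∑ m ∈ Ico lo hi, ((m : ZMod p) ^ 2)⁻¹ * (genPoly p (m + 1) hi).coeff a := by
  rcases le_total hi lo with h | h
  · simp [genPoly, Ico_eq_empty_of_le h, coeff_one]
  · induction h using Nat.decreasingInduction with
    | self => simp [genPoly_self p, coeff_one]
    | of_succ k hk ih =>
      rw [genPoly_succ_bot hk, sum_eq_sum_Ico_succ_bot hk, sub_mul, one_mul, coeff_sub, ih,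
        mul_assoc, coeff_C_mul, coeff_X_mul]
      ring

lemma hasResidue_ZAux_replicate {N : ℕ} (hN : N < p) (b lo : ℕ) (hlo : 1 ≤ lo) :
    HasResidue p (ZAux N (List.replicate b 2) lo)
      ((-1) ^ b * (genPoly p lo (N + 1)).coeff b) := by
  induction b generalizing lo with
  | zero => simpa [ZAux, coeff_zero_genPoly] using HasResidue.intCast (p := p) 1
  | succ b ih =>
    rw [List.replicate_succ, ZAux, coeff_succ_genPoly]
    have key : (-1) ^ (b + 1) * -∑ m ∈ Ico lo (N + 1),
          ((m : ZMod p) ^ 2)⁻¹ * (genPoly p (m + 1) (N + 1)).coeff b =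
        ∑ m ∈ Icc lo N, ((m : ZMod p)⁻¹) ^ 2 *
          ((-1) ^ b * (genPoly p (m + 1) (N + 1)).coeff b) := by
      rw [mul_neg, pow_succ, mul_neg_one, neg_mul, neg_neg, mul_sum]
      refine sum_congr (by rfl) fun m _ => ?_
      rw [inv_pow]
      ring
    rw [key]
    refine HasResidue.sum _ fun m hm => ?_
    obtain ⟨h1, h2⟩ := mem_Icc.mp hm
    rw [← inv_pow]
    exact ((HasResidue.inv_natCast (natCast_ne_zero_of_lt (by omega) (by omega))).pow 2).mul
      (ih (m + 1) (by omega))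

lemma hasResidue_ZAux {N : ℕ} (hN : N < p) (a b lo : ℕ) (hlo : 1 ≤ lo) :
    HasResidue p (ZAux N (List.replicate a 2 ++ 3 :: List.replicate b 2) lo)
      ((-1) ^ (a + b) * ∑ k ∈ Ico lo (N + 1), (genPoly p lo k).coeff a *
        ((k : ZMod p) ^ 3)⁻¹ * (genPoly p (k + 1) (N + 1)).coeff b) := by
  induction a generalizing lo with
  | zero =>
    rw [List.replicate_zero, List.nil_append, ZAux]
    have key : (-1) ^ (0 + b) * ∑ k ∈ Ico lo (N + 1), (genPoly p lo k).coeff 0 *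
          ((k : ZMod p) ^ 3)⁻¹ * (genPoly p (k + 1) (N + 1)).coeff b =
        ∑ k ∈ Icc lo N, ((k : ZMod p)⁻¹) ^ 3 *
          ((-1) ^ b * (genPoly p (k + 1) (N + 1)).coeff b) := by
      rw [mul_sum]
      refine sum_congr (by rfl) fun m _ => ?_
      rw [inv_pow, coeff_zero_genPoly]
      ring
    rw [key]
    refine HasResidue.sum _ fun m hm => ?_
    obtain ⟨h1, h2⟩ := mem_Icc.mp hm
    rw [← inv_pow]
    exact ((HasResidue.inv_natCast (natCast_ne_zero_of_lt (by omega) (by omega))).pow 3).mul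
      (hasResidue_ZAux_replicate hN b (m + 1) (by omega))
  | succ a ih =>
    rw [List.replicate_succ, List.cons_append, ZAux]
    have key : (-1) ^ (a + 1 + b) * ∑ k ∈ Ico lo (N + 1), (genPoly p lo k).coeff (a + 1) *
          ((k : ZMod p) ^ 3)⁻¹ * (genPoly p (k + 1) (N + 1)).coeff b =
        ∑ m ∈ Icc lo N, ((m : ZMod p)⁻¹) ^ 2 * ((-1) ^ (a + b) *
          ∑ k ∈ Ico (m + 1) (N + 1), (genPoly p (m + 1) k).coeff a *
            ((k : ZMod p) ^ 3)⁻¹ * (genPoly p (k + 1) (N + 1)).coeff b) := by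
      simp_rw [coeff_succ_genPoly, mul_sum, neg_mul, sum_mul, mul_neg, mul_sum, ← sum_neg_distrib]
      rw [sum_comm' (t' := Icc lo N) (s' := fun m => Ico (m + 1) (N + 1))
        (by intro x y; simp; omega)]
      refine sum_congr rfl fun m _ => sum_congr rfl fun k _ => ?_
      rw [inv_pow]
      ring
    rw [key]
    refine HasResidue.sum _ fun m hm => ?_
    obtain ⟨h1, h2⟩ := mem_Icc.mp hm
    rw [← inv_pow]
    exact ((HasResidue.inv_natCast (natCast_ne_zero_of_lt (by omega) (by omega))).pow 2).mul
      (ih (m + 1) (by omega))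

end GeneratingPolynomial

section PowerSums

variable {p : ℕ} [Fact p.Prime]

lemma sum_Ico_natCast_pow (l : ℕ) :
    ∑ v ∈ Ico 1 p, (v : ZMod p) ^ l = if p - 1 ∣ l then -1 else 0 := by
  have hbij : (∑ v ∈ Ico 1 p, (v : ZMod p) ^ l) = ∑ u : (ZMod p)ˣ, (u : ZMod p) ^ l :=
    Finset.sum_bij'
      (fun v hv ↦ Units.mk0 (v : ZMod p) (natCast_ne_zero_of_lt
        (by have := (mem_Ico.mp hv).1; omega) (mem_Ico.mp hv).2))
      (fun u _ ↦ (u : ZMod p).val)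
      (fun _ _ ↦ Finset.mem_univ _)
      (fun u _ ↦ by grind [u.ne_zero, ZMod.val_ne_zero, ZMod.val_lt])
      (fun v hv ↦ by simp [ZMod.val_cast_of_lt (Finset.mem_Ico.mp hv).2])
      (fun u _ ↦ Units.ext (ZMod.natCast_zmod_val _))
      (fun _ _ ↦ rfl)
  rw [hbij, FiniteField.sum_pow_units, ZMod.card]

lemma natCast_sub_eq_neg {k : ℕ} (hk : k ≤ p) : ((p - k : ℕ) : ZMod p) = -k := by
  rw [Nat.cast_sub hk]
  simp

omit [Fact p.Prime] in
lemma sum_Ico_eq_sum_half {M : Type*} [AddCommMonoid M] {n : ℕ} (hn : p = 2 * n + 1)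
    (f : ℕ → M) :
    ∑ k ∈ Ico 1 p, f k = ∑ k ∈ Ico 1 (n + 1), f k + ∑ k ∈ Ico 1 (n + 1), f (p - k) := by
  rw [← sum_Ico_consecutive f (show 1 ≤ n + 1 by omega) (show n + 1 ≤ p by omega),
    sum_Ico_reflect f 1 (by omega : n + 1 ≤ p + 1)]
  congr 2
  ext
  simp
  omega

lemma two_mul_sum_half_sq_pow {n : ℕ} (hn : p = 2 * n + 1) (m : ℕ) :
    2 * ∑ v ∈ Ico 1 (n + 1), ((v : ZMod p) ^ 2) ^ m = if n ∣ m then -1 else 0 := by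
  have h := sum_Ico_natCast_pow (p := p) (2 * m)
  rw [sum_Ico_eq_sum_half hn] at h
  have hrefl : ∑ k ∈ Ico 1 (n + 1), ((p - k : ℕ) : ZMod p) ^ (2 * m) =
      ∑ k ∈ Ico 1 (n + 1), (k : ZMod p) ^ (2 * m) :=
    sum_congr rfl fun k hk => by
      rw [natCast_sub_eq_neg (by have := (mem_Ico.mp hk).2; omega), pow_mul, pow_mul, neg_sq]
  rw [hrefl, ← two_mul] at h
  simp_rw [← pow_mul]
  rw [h, show p - 1 = 2 * n by omega]
  simp only [Nat.mul_dvd_mul_iff_left two_pos]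

lemma natCast_pow_card_sub_one {v : ℕ} (h0 : v ≠ 0) (hv : v < p) :
    (v : ZMod p) ^ (p - 1) = 1 :=
  ZMod.pow_card_sub_one_eq_one (natCast_ne_zero_of_lt h0 hv)

lemma coeff_eq_sum_eval_sq {n : ℕ} (hn : p = 2 * n + 1) {f : (ZMod p)[X]} {i : ℕ} (hi : i ≤ n)
    (hf : ∀ j ≤ f.natDegree, n ∣ j + (n - i) → j = i) :
    f.coeff i = -2 * ∑ v ∈ Ico 1 (n + 1), f.eval ((v : ZMod p) ^ 2) * (((v : ZMod p) ^ 2) ^ i)⁻¹ := by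
  have hinv : ∀ v ∈ Ico 1 (n + 1), (((v : ZMod p) ^ 2) ^ i)⁻¹ = ((v : ZMod p) ^ 2) ^ (n - i) := by
    intro v hv
    obtain ⟨h1, h2⟩ := mem_Ico.mp hv
    apply inv_eq_of_mul_eq_one_right
    rw [← pow_add, Nat.add_sub_cancel' hi, ← pow_mul, show 2 * n = p - 1 by omega,
      natCast_pow_card_sub_one (by omega) (by omega)]
  have hexp : ∑ v ∈ Ico 1 (n + 1), f.eval ((v : ZMod p) ^ 2) * (((v : ZMod p) ^ 2) ^ i)⁻¹ =
      ∑ j ∈ range (f.natDegree + 1), f.coeff j *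
        ∑ v ∈ Ico 1 (n + 1), ((v : ZMod p) ^ 2) ^ (j + (n - i)) := by
    simp_rw [mul_sum]
    rw [sum_comm]
    refine sum_congr rfl fun v hv => ?_
    rw [hinv v hv, eval_eq_sum_range, sum_mul]
    exact sum_congr rfl fun j _ => by rw [pow_add, mul_assoc]
  have hterm : ∀ j ∈ range (f.natDegree + 1),
      2 * (f.coeff j * ∑ v ∈ Ico 1 (n + 1), ((v : ZMod p) ^ 2) ^ (j + (n - i))) =
        if j = i then -f.coeff i else 0 := by
    intro j hj
    rw [mul_left_comm, two_mul_sum_half_sq_pow hn]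
    by_cases hji : j = i
    · subst hji
      rw [if_pos (by rw [Nat.add_sub_cancel' hi]), if_pos rfl]
      ring
    · rw [if_neg fun h => hji (hf j (by simpa [Nat.lt_succ_iff] using hj) h), if_neg hji, mul_zero]
  rw [hexp, neg_mul, mul_sum, sum_congr rfl hterm, sum_ite_eq']
  split_ifs with h
  · rw [neg_neg]
  · rw [neg_zero, coeff_eq_zero_of_natDegree_lt]
    simpa using h

lemma eval_sq_genPoly_eq_zero {lo hi v : ℕ} (h : lo ≤ v) (h' : v < hi) (h0 : (v : ZMod p) ≠ 0) :
    (genPoly p lo hi).eval ((v : ZMod p) ^ 2) = 0 := by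
  rw [genPoly, eval_prod]
  refine prod_eq_zero (mem_Ico.mpr ⟨h, h'⟩) ?_
  simp [h0]

lemma coeff_genPoly_half {n : ℕ} (hn : p = 2 * n + 1) {i : ℕ} (h0 : i ≠ 0) (hi : i < n) :
    (genPoly p 1 (n + 1)).coeff i = 0 := by
  rw [coeff_eq_sum_eval_sq hn hi.le, sum_eq_zero, mul_zero]
  · intro v hv
    obtain ⟨h1, h2⟩ := mem_Ico.mp hv
    rw [eval_sq_genPoly_eq_zero h1 h2 (natCast_ne_zero_of_lt (by omega) (by omega)), zero_mul]
  · intro j hj hdvd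
    have hj' : j ≤ n := hj.trans (natDegree_genPoly_le 1 (n + 1))
    obtain ⟨c, hc⟩ := hdvd
    rcases c with _ | _ | c
    · omega
    · omega
    · have : n * (c + 1 + 1) = n * c + 2 * n := by ring
      omega

lemma coeff_mul_genPoly_half {n : ℕ} (hn : p = 2 * n + 1) (f : (ZMod p)[X]) {i : ℕ}
    (hi : i < n) : (f * genPoly p 1 (n + 1)).coeff i = f.coeff i := by
  rw [coeff_mul, sum_eq_single (i, 0)]
  · rw [coeff_zero_genPoly, mul_one]
  · rintro ⟨x, y⟩ hxy hne
    rw [HasAntidiagonal.mem_antidiagonal] at hxy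
    simp only at hxy
    rw [coeff_genPoly_half hn, mul_zero]
    · rintro rfl
      exact hne (by rw [← hxy, add_zero])
    · omega
  · intro h
    exact absurd (by simp) h

lemma genPoly_reflect {lo hi : ℕ} (hhi : hi ≤ p + 1) :
    genPoly p (p + 1 - hi) (p + 1 - lo) = genPoly p lo hi := by
  rw [genPoly, ← prod_Ico_reflect _ _ hhi]
  refine prod_congr rfl fun j hj => ?_
  rw [natCast_sub_eq_neg (by have := (mem_Ico.mp hj).2; omega), neg_sq]

/-- The contribution of the indices `k ≤ n` to the coefficient sum. -/
noncomputable def halfSum (p n a b : ℕ) : ZMod p :=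
  ∑ k ∈ Ico 1 (n + 1), (genPoly p 1 k).coeff a * ((k : ZMod p) ^ 3)⁻¹ *
    (genPoly p (k + 1) (n + 1)).coeff b

lemma sum_coeff_genPoly_eq_halfSum_sub {n : ℕ} (hn : p = 2 * n + 1) {a b : ℕ} (ha : a < n)
    (hb : b < n) :
    ∑ k ∈ Ico 1 p, (genPoly p 1 k).coeff a * ((k : ZMod p) ^ 3)⁻¹ *
      (genPoly p (k + 1) p).coeff b = halfSum p n a b - halfSum p n b a := by
  have htop : genPoly p (n + 1) p = genPoly p 1 (n + 1) := by
    rw [← genPoly_reflect (lo := 1) (hi := n + 1) (by omega)]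
    congr 1
    omega
  have hcoeff : ∀ k ∈ Ico 1 (n + 1), ∀ i < n,
      (genPoly p (k + 1) p).coeff i = (genPoly p (k + 1) (n + 1)).coeff i := by
    intro k hk i hi
    have := (mem_Ico.mp hk).2
    rw [← genPoly_mul_genPoly p (show k + 1 ≤ n + 1 by omega) (show n + 1 ≤ p by omega), htop,
      coeff_mul_genPoly_half hn _ hi]
  rw [sum_Ico_eq_sum_half hn, sub_eq_add_neg, halfSum, halfSum, ← sum_neg_distrib]
  congr 1
  · exact sum_congr rfl fun k hk => by rw [hcoeff k hk b hb]
  · refine sum_congr rfl fun k hk => ?_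
    obtain ⟨h1, h2⟩ := mem_Ico.mp hk
    have hlow : genPoly p 1 (p - k) = genPoly p (k + 1) p := by
      rw [← genPoly_reflect (lo := 1) (by omega)]
      congr 1
      omega
    have hhigh : genPoly p (p - k + 1) p = genPoly p 1 k := by
      rw [← genPoly_reflect (lo := 1) (hi := k) (by omega)]
      congr 1
      omega
    rw [hlow, hhigh, hcoeff k hk a ha, natCast_sub_eq_neg (by omega), Odd.neg_pow (by decide),
      inv_neg]
    ring

end PowerSums

section NodeValues

lemma prod_Ico_sub_of_top {R : Type*} [CommRing R] (a d : ℕ) :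
    ∏ j ∈ Ico a (a + d), (((a + d : ℕ) : R) - j) = d.factorial := by
  rw [prod_Ico_eq_prod_range, Nat.add_sub_cancel_left]
  induction d with
  | zero => simp
  | succ d ih =>
    rw [prod_range_succ', Nat.factorial_succ, Nat.cast_mul, mul_comm ((d + 1 : ℕ) : R), ← ih]
    congr 1
    · exact prod_congr rfl fun j _ => by push_cast; ring
    · push_cast
      ring

lemma prod_Ico_sub_of_bot {R : Type*} [CommRing R] (a d : ℕ) :
    ∏ j ∈ Ico (a + 1) (a + 1 + d), ((a : R) - j) = (-1) ^ d * d.factorial := by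
  induction d with
  | zero => simp
  | succ d ih =>
    rw [← add_assoc, prod_Ico_succ_top (by omega), ih, Nat.factorial_succ]
    push_cast
    ring

lemma prod_Ico_natCast_mul_factorial {R : Type*} [CommRing R] {a c : ℕ} (h : a ≤ c) :
    (∏ j ∈ Ico (a + 1) (c + 1), (j : R)) * a.factorial = c.factorial := by
  induction c, h using Nat.le_induction with
  | base => simp
  | succ c hc ih =>
    rw [prod_Ico_succ_top (by omega), Nat.factorial_succ, Nat.cast_mul, ← ih]
    ring

variable {p : ℕ} [Fact p.Prime]

lemma sum_alternating_factorial {n β N : ℕ} (hn : p = 2 * n + 1) (hβ : 1 ≤ β)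
    (hα : β + N + 1 ≤ n) :
    ∑ k ∈ Ico β (β + N + 2), (-1 : ZMod p) ^ k * (β + N + k).factorial /
      ((β + N + 1 - k).factorial * k * (k - β).factorial * (k + β).factorial) =
      (-1) ^ β / ((β + N + 1 : ℕ) * β) := by
  have hinj : Set.InjOn (Nat.cast : ℕ → ZMod p) ↑(insert 0 (Ico β (β + N + 2))) := by
    intro x hx y hy hxy
    have hlt : ∀ z ∈ (insert 0 (Ico β (β + N + 2)) : Finset ℕ), z < p := by
      intro z hz
      rw [mem_insert, mem_Ico] at hz
      omega
    have := (ZMod.natCast_eq_natCast_iff' x y p).mp hxy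
    rwa [Nat.mod_eq_of_lt (hlt x hx), Nat.mod_eq_of_lt (hlt y hy)] at this
  have h0 : 0 ∉ Ico β (β + N + 2) := by simp; omega
  have hcard : #(insert 0 (Ico β (β + N + 2))) = N + 3 := by
    rw [card_insert_of_notMem h0, Nat.card_Ico]
    omega
  set P : (ZMod p)[X] := ∏ i ∈ Ico (β + 1) (β + N + 1), (X + C (i : ZMod p)) with hP
  have hdeg : P.natDegree ≤ N := by
    refine (natDegree_prod_le _ _).trans ?_
    refine (sum_le_card_nsmul _ _ 1 fun j _ => ?_).trans (by simp)
    compute_degree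
  have heval : ∀ k : ℕ, P.eval (k : ZMod p) * (k + β).factorial = (k + β + N).factorial := by
    intro k
    rw [hP, eval_prod, ← prod_Ico_natCast_mul_factorial (show k + β ≤ k + β + N by omega)]
    congr 1
    rw [show k + β + 1 = β + 1 + k by ring, show k + β + N + 1 = β + N + 1 + k by ring,
      ← prod_Ico_add' (fun j : ℕ => (j : ZMod p))]
    exact prod_congr rfl fun j _ => by simp [add_comm]
  have hlag := Lagrange.coeff_eq_sum hinj (P := P)
    (by rw [hcard]; exact (degree_le_of_natDegree_le hdeg).trans_lt (by norm_cast; omega))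
  rw [hcard, coeff_eq_zero_of_natDegree_lt (by omega), sum_insert h0, erase_insert h0] at hlag
  have hprod0 : (∏ j ∈ Ico β (β + N + 2), (((0 : ℕ) : ZMod p) - j)) * (β - 1).factorial =
      (-1) ^ N * (β + N + 1).factorial := by
    obtain ⟨γ, rfl⟩ : ∃ γ, β = γ + 1 := ⟨β - 1, by omega⟩
    simp only [Nat.cast_zero, zero_sub, prod_neg, Nat.card_Ico, Nat.add_sub_cancel]
    rw [mul_assoc, prod_Ico_natCast_mul_factorial (show γ ≤ γ + 1 + N + 1 by omega),
      show γ + 1 + N + 2 - (γ + 1) = N + 2 by omega]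
    ring
  have hprod : ∀ k ∈ Ico β (β + N + 2),
      ∏ j ∈ (insert 0 (Ico β (β + N + 2))).erase k, ((k : ZMod p) - j) =
        k * (k - β).factorial * ((-1) ^ (β + N + 1 - k) * (β + N + 1 - k).factorial) := by
    intro k hk
    obtain ⟨h1, h2⟩ := mem_Ico.mp hk
    have hset : (insert 0 (Ico β (β + N + 2))).erase k =
        insert 0 (Ico β k ∪ Ico (k + 1) (β + N + 2)) := by
      ext x
      simp
      omega
    rw [hset, prod_insert (by simp; omega), prod_union]
    · have hA := prod_Ico_sub_of_top (R := ZMod p) β (k - β)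
      have hB := prod_Ico_sub_of_bot (R := ZMod p) k (β + N + 1 - k)
      rw [Nat.add_sub_cancel' h1] at hA
      rw [show k + 1 + (β + N + 1 - k) = β + N + 2 by omega] at hB
      rw [hA, hB]
      simp
      ring
    · rw [disjoint_left]
      intro x
      simp
      omega
  have hterm : ∀ k ∈ Ico β (β + N + 2), P.eval (k : ZMod p) /
      ∏ j ∈ (insert 0 (Ico β (β + N + 2))).erase k, ((k : ZMod p) - j) =
      (-1) ^ (β + N + 1) * ((-1 : ZMod p) ^ k * (β + N + k).factorial /
      ((β + N + 1 - k).factorial * k * (k - β).factorial * (k + β).factorial)) := by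
    intro k hk
    rw [hprod k hk]
    obtain ⟨h1, h2⟩ := mem_Ico.mp hk
    have hk0 : (k : ZMod p) ≠ 0 := natCast_ne_zero_of_lt (by omega) (by omega)
    have f1 := natCast_factorial_ne_zero (p := p) (m := β + N + 1 - k) (by omega)
    have f2 := natCast_factorial_ne_zero (p := p) (m := k - β) (by omega)
    have f3 := natCast_factorial_ne_zero (p := p) (m := k + β) (by omega)
    have hs : (-1 : ZMod p) ^ (β + N + 1) = (-1) ^ (β + N + 1 - k) * (-1) ^ k := by
      rw [← pow_add]
      congr 1
      omega
    have hev := heval k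
    rw [show k + β + N = β + N + k by ring] at hev
    rw [← hev, hs]
    have s1 : ((-1 : ZMod p) ^ (β + N + 1 - k)) * (-1) ^ (β + N + 1 - k) = 1 := by
      rw [← mul_pow]
      simp
    have s2 : ((-1 : ZMod p) ^ k) * (-1) ^ k = 1 := by
      rw [← mul_pow]
      simp
    have s3 : ((-1 : ZMod p) ^ (β + N + 1 - k)) ≠ 0 := left_ne_zero_of_mul_eq_one s1
    field_simp
    linear_combination (-eval (k : ZMod p) P) * s1 * (-1 : ZMod p) ^ k * (-1) ^ k -
      eval (k : ZMod p) P * s2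
  rw [sum_congr rfl hterm, ← mul_sum] at hlag
  have hev0 := heval 0
  simp only [zero_add] at hev0
  have f1 := natCast_factorial_ne_zero (p := p) (m := β) (by omega)
  have f2 := natCast_factorial_ne_zero (p := p) (m := β - 1) (by omega)
  have f3 := natCast_factorial_ne_zero (p := p) (m := β + N) (by omega)
  have hβ0 : (β : ZMod p) ≠ 0 := natCast_ne_zero_of_lt (by omega) (by omega)
  have hα0 : ((β + N + 1 : ℕ) : ZMod p) ≠ 0 := natCast_ne_zero_of_lt (by omega) (by omega)
  have hfβ : ((β.factorial : ℕ) : ZMod p) = β * (β - 1).factorial := by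
    rw [← Nat.mul_factorial_pred (by omega)]
    push_cast
    ring
  have hzero : eval ((0 : ℕ) : ZMod p) P /
      ∏ j ∈ Ico β (β + N + 2), (((0 : ℕ) : ZMod p) - j) =
        (-1) ^ N / ((β + N + 1 : ℕ) * β) := by
    have hne : (∏ j ∈ Ico β (β + N + 2), (((0 : ℕ) : ZMod p) - j)) ≠ 0 :=
      prod_ne_zero_iff.mpr fun j hj => by
        have := mem_Ico.mp hj
        rw [Nat.cast_zero, zero_sub, neg_ne_zero]
        exact natCast_ne_zero_of_lt (by omega) (by omega)
    rw [Nat.factorial_succ, Nat.cast_mul, ← hev0, hfβ] at hprod0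
    have s1 : ((-1 : ZMod p) ^ N) * (-1) ^ N = 1 := by
      rw [← mul_pow]
      simp
    rw [div_eq_div_iff hne (mul_ne_zero hα0 hβ0)]
    apply mul_right_cancel₀ f2
    linear_combination (-(-1 : ZMod p) ^ N) * hprod0 - (((β + N + 1 : ℕ) : ZMod p) *
      eval ((0 : ℕ) : ZMod p) P * β * ((β - 1).factorial : ZMod p)) * s1
  rw [hzero] at hlag
  have s1 : ((-1 : ZMod p) ^ N) * (-1) ^ N = 1 := by
    rw [← mul_pow]
    simp
  have s2 : ((-1 : ZMod p) ^ β) * (-1) ^ β = 1 := by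
    rw [← mul_pow]
    simp
  rw [pow_succ, pow_add] at hlag
  generalize (∑ k ∈ Ico β (β + N + 2), (-1 : ZMod p) ^ k * (β + N + k).factorial /
      ((β + N + 1 - k).factorial * k * (k - β).factorial * (k + β).factorial)) = S at hlag ⊢
  rw [div_eq_mul_inv] at hlag ⊢
  generalize (((β + N + 1 : ℕ) : ZMod p) * β)⁻¹ = c at hlag ⊢
  linear_combination (-1 : ZMod p) ^ N * (-1) ^ β * hlag + (-1) ^ β * c * s1 -
    S * s2 * (-1 : ZMod p) ^ N * (-1 : ZMod p) ^ N - S * s1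

end NodeValues

section HalfSum

variable {p : ℕ} [Fact p.Prime]

lemma factorial_sub_mul_factorial_add {n : ℕ} (hn : p = 2 * n + 1) {β : ℕ} (hβ : β ≤ n) :
    ((n - β).factorial : ZMod p) * (n + β).factorial = (-1) ^ β * (n.factorial : ZMod p) ^ 2 := by
  induction β with
  | zero => simp [sq]
  | succ β ih =>
    obtain ⟨m, rfl⟩ : ∃ m, n = β + 1 + m := ⟨n - (β + 1), by omega⟩
    have ih := ih (by omega)
    have hm : ((m + 1 : ℕ) : ZMod p) ≠ 0 := natCast_ne_zero_of_lt (by omega) (by omega)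
    have hp : ((β + 1 + m + β + 1 : ℕ) : ZMod p) = -(m + 1 : ℕ) := by
      rw [← natCast_sub_eq_neg (by omega)]
      congr 1
      omega
    rw [show β + 1 + m - β = m + 1 by omega, Nat.factorial_succ, Nat.cast_mul] at ih
    rw [show β + 1 + m - (β + 1) = m by omega, ← add_assoc, Nat.factorial_succ, Nat.cast_mul, hp,
      pow_succ]
    linear_combination -ih

lemma eval_sq_genPoly_top {n : ℕ} (hn : p = 2 * n + 1) {β k : ℕ} (hβ : 1 ≤ β) (hβk : β ≤ k)
    (hk : k ≤ n) :
    (genPoly p (k + 1) (n + 1)).eval ((β : ZMod p) ^ 2) =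
      (-1) ^ β * (k.factorial : ZMod p) ^ 2 / ((k - β).factorial * (k + β).factorial) := by
  induction hk using Nat.decreasingInduction with
  | self =>
    have f1 := natCast_factorial_ne_zero (p := p) (m := n - β) (by omega)
    have f2 := natCast_factorial_ne_zero (p := p) (m := n + β) (by omega)
    rw [genPoly_self, eval_one, ← factorial_sub_mul_factorial_add hn hβk,
      div_self (mul_ne_zero f1 f2)]
  | of_succ k hk ih =>
    obtain ⟨c, rfl⟩ := Nat.exists_eq_add_of_le hβk
    rw [genPoly_succ_bot (by omega), eval_mul, ih (by omega),
      show β + c + 1 - β = c + 1 by omega, show β + c - β = c by omega,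
      show β + c + 1 + β = β + c + β + 1 by ring, Nat.factorial_succ, Nat.factorial_succ,
      Nat.factorial_succ]
    have f1 := natCast_factorial_ne_zero (p := p) (m := c) (by omega)
    have f2 := natCast_factorial_ne_zero (p := p) (m := β + c + β) (by omega)
    have f3 : ((β + c + 1 : ℕ) : ZMod p) ≠ 0 := natCast_ne_zero_of_lt (by omega) (by omega)
    have f4 : ((c + 1 : ℕ) : ZMod p) ≠ 0 := natCast_ne_zero_of_lt (by omega) (by omega)
    have f5 : ((β + c + β + 1 : ℕ) : ZMod p) ≠ 0 := natCast_ne_zero_of_lt (by omega) (by omega)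
    simp only [eval_sub, eval_one, eval_mul, eval_C, eval_X, Nat.cast_mul]
    field_simp
    push_cast
    ring

lemma eval_sq_genPoly_bot {k α : ℕ} (hkα : k + 1 ≤ α) (hα : 2 * α < p) :
    (genPoly p 1 (k + 1)).eval ((α : ZMod p) ^ 2) =
      (-1) ^ k * ((α + k).factorial : ZMod p) /
        (α * (α - (k + 1)).factorial * (k.factorial : ZMod p) ^ 2) := by
  have hα0 : (α : ZMod p) ≠ 0 := natCast_ne_zero_of_lt (by omega) (by omega)
  induction k with
  | zero =>
    have f1 := natCast_factorial_ne_zero (p := p) (m := α - 1) (by omega)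
    have h : (α.factorial : ZMod p) = α * (α - 1).factorial := by
      rw [← Nat.mul_factorial_pred (by omega)]
      push_cast
      ring
    simp [genPoly_self, h, hα0, f1]
  | succ k ih =>
    obtain ⟨c, rfl⟩ : ∃ c, α = c + (k + 1 + 1) := ⟨α - (k + 1 + 1), by omega⟩
    rw [genPoly_succ_top (by omega), eval_mul, ih (by omega),
      show c + (k + 1 + 1) - (k + 1) = c + 1 by omega, Nat.add_sub_cancel, ← add_assoc _ k 1,
      Nat.factorial_succ (c + (k + 1 + 1) + k), Nat.factorial_succ c, Nat.factorial_succ k]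
    have f1 := natCast_factorial_ne_zero (p := p) (m := c) (by omega)
    have f2 := natCast_factorial_ne_zero (p := p) (m := k) (by omega)
    have f3 : ((c + 1 : ℕ) : ZMod p) ≠ 0 := natCast_ne_zero_of_lt (by omega) (by omega)
    have f4 : ((k + 1 : ℕ) : ZMod p) ≠ 0 := natCast_ne_zero_of_lt (by omega) (by omega)
    simp only [eval_sub, eval_one, eval_mul, eval_C, eval_X, Nat.cast_mul]
    field_simp
    push_cast
    ring

lemma sum_eval_sq_genPoly {n : ℕ} (hn : p = 2 * n + 1) {α β : ℕ} (hα : 1 ≤ α) (hαn : α ≤ n)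
    (hβ : 1 ≤ β) (hβn : β ≤ n) :
    ∑ k ∈ Ico 1 (n + 1), (genPoly p 1 k).eval ((α : ZMod p) ^ 2) * ((k : ZMod p) ^ 3)⁻¹ *
      (genPoly p (k + 1) (n + 1)).eval ((β : ZMod p) ^ 2) =
      -(((α : ZMod p) ^ 2)⁻¹ *
        (if β < α then (β : ZMod p)⁻¹ else if β = α then (2 * (β : ZMod p))⁻¹ else 0)) := by
  have hα0 : (α : ZMod p) ≠ 0 := natCast_ne_zero_of_lt (by omega) (by omega)
  have hβ0 : (β : ZMod p) ≠ 0 := natCast_ne_zero_of_lt (by omega) (by omega)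
  have hrestrict : ∑ k ∈ Ico 1 (n + 1),
      (genPoly p 1 k).eval ((α : ZMod p) ^ 2) * ((k : ZMod p) ^ 3)⁻¹ *
        (genPoly p (k + 1) (n + 1)).eval ((β : ZMod p) ^ 2) =
      ∑ k ∈ Ico β (α + 1), -((-1) ^ β * (α : ZMod p)⁻¹) *
        ((-1 : ZMod p) ^ k * (α - 1 + k).factorial /
          ((α - k).factorial * k * (k - β).factorial * (k + β).factorial)) := by
    symm
    apply sum_subset_zero_on_sdiff
    · intro k
      simp
      omega
    · intro k hk
      simp only [mem_sdiff, mem_Ico, not_and, not_lt] at hk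
      obtain ⟨⟨h1, h2⟩, h3⟩ := hk
      by_cases hkβ : k < β
      · rw [eval_sq_genPoly_eq_zero (v := β) (by omega) (by omega) hβ0, mul_zero]
      · rw [eval_sq_genPoly_eq_zero (v := α) (by omega) (by omega) hα0, zero_mul, zero_mul]
    · intro k hk
      obtain ⟨h1, h2⟩ := mem_Ico.mp hk
      rw [eval_sq_genPoly_top hn hβ h1 (by omega)]
      obtain ⟨l, rfl⟩ : ∃ l, k = l + 1 := ⟨k - 1, by omega⟩
      rw [eval_sq_genPoly_bot (by omega) (by omega), show α - 1 + (l + 1) = α + l by omega,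
        Nat.factorial_succ l]
      have f1 := natCast_factorial_ne_zero (p := p) (m := l) (by omega)
      have f2 := natCast_factorial_ne_zero (p := p) (m := α - (l + 1)) (by omega)
      have f3 := natCast_factorial_ne_zero (p := p) (m := l + 1 - β) (by omega)
      have f4 := natCast_factorial_ne_zero (p := p) (m := l + 1 + β) (by omega)
      have f5 : ((l + 1 : ℕ) : ZMod p) ≠ 0 := natCast_ne_zero_of_lt (by omega) (by omega)
      simp only [Nat.cast_mul]
      field_simp
      ring
  have s1 : ((-1 : ZMod p) ^ β) * (-1) ^ β = 1 := by
    rw [← mul_pow]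
    simp
  rw [hrestrict, ← mul_sum]
  rcases lt_trichotomy β α with h | rfl | h
  · obtain ⟨N, rfl⟩ : ∃ N, α = β + N + 1 := ⟨α - β - 1, by omega⟩
    rw [if_pos h]
    simp only [Nat.add_sub_cancel]
    rw [sum_alternating_factorial hn hβ hαn]
    field_simp
    linear_combination -s1
  · have f1 := natCast_factorial_ne_zero (p := p) (m := β + β - 1) (by omega)
    have f2 : ((β + β : ℕ) : ZMod p) ≠ 0 := natCast_ne_zero_of_lt (by omega) (by omega)
    have f3 : (2 : ZMod p) ≠ 0 := by
      exact_mod_cast natCast_ne_zero_of_lt (p := p) (m := 2) (by omega) (by omega)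
    have h : ((β + β).factorial : ZMod p) = (2 * β) * (β + β - 1).factorial := by
      rw [← Nat.mul_factorial_pred (by omega)]
      push_cast
      ring
    rw [if_neg (lt_irrefl _), if_pos rfl, Nat.Ico_succ_singleton, sum_singleton, Nat.sub_self, h,
      show β - 1 + β = β + β - 1 by omega]
    simp only [Nat.factorial_zero, Nat.cast_one]
    field_simp
    linear_combination -s1
  · rw [if_neg (by omega), if_neg (by omega), Ico_eq_empty (by omega)]
    simp

lemma halfSum_eq {n : ℕ} (hn : p = 2 * n + 1) {a b : ℕ} (ha : a < n) (hb : b < n) :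
    halfSum p n a b =
      -4 * ∑ α ∈ Ico 1 (n + 1), ((α : ZMod p) ^ (2 * a + 2))⁻¹ *
        ∑ β ∈ Ico 1 α, ((β : ZMod p) ^ (2 * b + 1))⁻¹ -
      2 * ∑ α ∈ Ico 1 (n + 1), ((α : ZMod p) ^ (2 * b + 1 + (2 * a + 2)))⁻¹ := by
  have hdft : ∀ f : (ZMod p)[X], f.natDegree < n → ∀ i < n,
      f.coeff i = -2 * ∑ v ∈ Ico 1 (n + 1), f.eval ((v : ZMod p) ^ 2) *
        (((v : ZMod p) ^ 2) ^ i)⁻¹ := by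
    intro f hf i hi
    refine coeff_eq_sum_eval_sq hn hi.le fun j hj hdvd => ?_
    obtain ⟨c, hc⟩ := hdvd
    rcases c with _ | _ | c
    · omega
    · omega
    · have : n * (c + 1 + 1) = n * c + 2 * n := by ring
      omega
  have hexpand : halfSum p n a b = 4 * ∑ α ∈ Ico 1 (n + 1), ∑ β ∈ Ico 1 (n + 1),
      (((α : ZMod p) ^ 2) ^ a)⁻¹ * (((β : ZMod p) ^ 2) ^ b)⁻¹ *
        ∑ k ∈ Ico 1 (n + 1), (genPoly p 1 k).eval ((α : ZMod p) ^ 2) * ((k : ZMod p) ^ 3)⁻¹ *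
          (genPoly p (k + 1) (n + 1)).eval ((β : ZMod p) ^ 2) := by
    simp_rw [mul_sum]
    rw [halfSum, sum_congr rfl fun α _ => sum_comm, sum_comm]
    refine sum_congr rfl fun k hk => ?_
    obtain ⟨h1, h2⟩ := mem_Ico.mp hk
    have hd1 := natDegree_genPoly_le (p := p) 1 k
    have hd2 := natDegree_genPoly_le (p := p) (k + 1) (n + 1)
    rw [hdft _ (by omega) a ha, hdft _ (by omega) b hb, mul_assoc, mul_assoc, sum_mul, mul_sum]
    refine sum_congr rfl fun α _ => ?_
    rw [mul_sum, mul_sum, mul_sum, mul_sum]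
    refine sum_congr rfl fun β _ => ?_
    ring
  have f2 : (2 : ZMod p) ≠ 0 := by
    exact_mod_cast natCast_ne_zero_of_lt (p := p) (m := 2) (by omega) (by omega)
  rw [hexpand, mul_sum, mul_sum, mul_sum, ← sum_sub_distrib]
  refine sum_congr rfl fun α hα => ?_
  obtain ⟨hα1, hα2⟩ := mem_Ico.mp hα
  have hα0 : (α : ZMod p) ≠ 0 := natCast_ne_zero_of_lt (by omega) (by omega)
  have hinner : ∀ β ∈ Ico 1 (n + 1), (((α : ZMod p) ^ 2) ^ a)⁻¹ * (((β : ZMod p) ^ 2) ^ b)⁻¹ *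
        ∑ k ∈ Ico 1 (n + 1), (genPoly p 1 k).eval ((α : ZMod p) ^ 2) * ((k : ZMod p) ^ 3)⁻¹ *
          (genPoly p (k + 1) (n + 1)).eval ((β : ZMod p) ^ 2) =
      (if β < α then -((α : ZMod p) ^ (2 * a + 2))⁻¹ * ((β : ZMod p) ^ (2 * b + 1))⁻¹ else 0) +
        (if β = α then -(2 : ZMod p)⁻¹ * ((α : ZMod p) ^ (2 * b + 1 + (2 * a + 2)))⁻¹ else 0) := by
    intro β hβ
    obtain ⟨hβ1, hβ2⟩ := mem_Ico.mp hβ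
    have hβ0 : (β : ZMod p) ≠ 0 := natCast_ne_zero_of_lt (by omega) (by omega)
    rw [sum_eval_sq_genPoly hn hα1 (by omega) hβ1 (by omega)]
    rcases lt_trichotomy β α with h | rfl | h
    · simp only [if_pos h, if_neg h.ne]
      field_simp
      ring
    · simp only [lt_irrefl, if_false, if_true]
      field_simp
      ring
    · simp [h.ne', not_lt_of_gt h]
  have hfilter : ∑ β ∈ Ico 1 (n + 1),
      (if β < α then -((α : ZMod p) ^ (2 * a + 2))⁻¹ * ((β : ZMod p) ^ (2 * b + 1))⁻¹ else 0) =
      ∑ β ∈ Ico 1 α, -((α : ZMod p) ^ (2 * a + 2))⁻¹ * ((β : ZMod p) ^ (2 * b + 1))⁻¹ := by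
    rw [← sum_filter]
    congr 1
    ext
    simp
    omega
  rw [sum_congr rfl hinner, sum_add_distrib, hfilter, sum_ite_eq', if_pos hα, ← mul_sum]
  linear_combination (-2) * ((α : ZMod p) ^ (2 * b + 1 + (2 * a + 2)))⁻¹ * mul_inv_cancel₀ f2

end HalfSum

section DoubleSum

variable {p : ℕ} [Fact p.Prime]

/-- The truncated double zeta value `∑_{1 ≤ β < α < p} 1 / (β ^ s α ^ t)` in `𝔽_p`. -/
def doubleSum (p s t : ℕ) : ZMod p :=
  ∑ α ∈ Ico 1 p, ((α : ZMod p) ^ t)⁻¹ * ∑ β ∈ Ico 1 α, ((β : ZMod p) ^ s)⁻¹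

lemma sum_Ico_inv_pow_reflect {s : ℕ} (hs : Odd s) {α : ℕ} (hα : 1 ≤ α) (hαp : 2 * α < p) :
    ∑ β ∈ Ico 1 (p - α), ((β : ZMod p) ^ s)⁻¹ = ∑ β ∈ Ico 1 (α + 1), ((β : ZMod p) ^ s)⁻¹ := by
  have hodd : ∀ lo hi, hi ≤ p + 1 → ∑ β ∈ Ico (p + 1 - hi) (p + 1 - lo), ((β : ZMod p) ^ s)⁻¹ =
      -∑ β ∈ Ico lo hi, ((β : ZMod p) ^ s)⁻¹ := by
    intro lo hi h
    rw [← sum_Ico_reflect _ _ h, ← sum_neg_distrib]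
    refine sum_congr rfl fun β hβ => ?_
    rw [natCast_sub_eq_neg (by have := (mem_Ico.mp hβ).2; omega), hs.neg_pow, inv_neg]
  have hmid := hodd (α + 1) (p - α) (by omega)
  rw [show p + 1 - (p - α) = α + 1 by omega, show p + 1 - (α + 1) = p - α by omega] at hmid
  have h2 : (2 : ZMod p) ≠ 0 := by
    exact_mod_cast natCast_ne_zero_of_lt (p := p) (m := 2) (by omega) (by omega)
  have hzero : ∑ β ∈ Ico (α + 1) (p - α), ((β : ZMod p) ^ s)⁻¹ = 0 := by
    apply (mul_eq_zero.mp _).resolve_left h2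
    linear_combination hmid
  rw [← sum_Ico_consecutive _ (show 1 ≤ α + 1 by omega) (show α + 1 ≤ p - α by omega), hzero,
    add_zero]

lemma doubleSum_eq_half {n : ℕ} (hn : p = 2 * n + 1) {s t : ℕ} (hs : Odd s) (ht : Even t) :
    doubleSum p s t =
      2 * ∑ α ∈ Ico 1 (n + 1), ((α : ZMod p) ^ t)⁻¹ * ∑ β ∈ Ico 1 α, ((β : ZMod p) ^ s)⁻¹ +
      ∑ α ∈ Ico 1 (n + 1), ((α : ZMod p) ^ (s + t))⁻¹ := by
  rw [doubleSum, sum_Ico_eq_sum_half hn, mul_sum, ← sum_add_distrib, ← sum_add_distrib]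
  refine sum_congr rfl fun α hα => ?_
  obtain ⟨h1, h2⟩ := mem_Ico.mp hα
  rw [sum_Ico_inv_pow_reflect hs h1 (by omega), natCast_sub_eq_neg (by omega), ht.neg_pow,
    sum_Ico_succ_top h1, pow_add, mul_inv]
  ring

lemma halfSum_eq_doubleSum {n : ℕ} (hn : p = 2 * n + 1) {a b : ℕ} (ha : a < n) (hb : b < n) :
    halfSum p n a b = -2 * doubleSum p (2 * b + 1) (2 * a + 2) := by
  rw [halfSum_eq hn ha hb, doubleSum_eq_half hn ⟨b, rfl⟩ ⟨a + 1, by ring⟩]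
  ring

lemma inv_natCast_pow {v t : ℕ} (h0 : v ≠ 0) (hv : v < p) (ht : t ≤ p - 1) :
    ((v : ZMod p) ^ t)⁻¹ = (v : ZMod p) ^ (p - 1 - t) := by
  apply inv_eq_of_mul_eq_one_right
  rw [← pow_add, Nat.add_sub_cancel' ht, natCast_pow_card_sub_one h0 hv]

lemma natCast_choose_sub {s t : ℕ} (hst : s + t ≤ p) (ht : Even t) (htp : t < p) :
    (((p - s).choose t : ℕ) : ZMod p) = ((s + t - 1).choose t : ℕ) := by
  apply mul_left_cancel₀ (natCast_factorial_ne_zero htp)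
  rw [← Nat.cast_mul, ← Nat.cast_mul, ← Nat.descFactorial_eq_factorial_mul_choose,
    ← Nat.ascFactorial_eq_factorial_mul_choose', Nat.descFactorial_eq_prod_range,
    Nat.ascFactorial_eq_prod_range, Nat.cast_prod, Nat.cast_prod]
  have : ∀ i ∈ range t, ((p - s - i : ℕ) : ZMod p) = -1 * (s + i : ℕ) := by
    intro i hi
    have := mem_range.mp hi
    rw [Nat.sub_sub, natCast_sub_eq_neg (by omega), neg_one_mul]
  rw [prod_congr rfl this, prod_mul_distrib, prod_const, card_range, ht.neg_one_pow, one_mul]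

lemma doubleSum_eq {s t : ℕ} (hs : 1 ≤ s) (ht : 1 ≤ t) (hst : s + t + 1 < p) (ht' : Even t)
    {z : ZMod p} (hz : HasResidue p (_root_.bernoulli (p - (s + t))) z) :
    doubleSum p s t = (s : ZMod p)⁻¹ * ((s + t - 1).choose t : ℕ) * z := by
  obtain ⟨m, hm⟩ : ∃ m, p = m + s + 1 := ⟨p - s - 1, by omega⟩
  have hbern : ∀ i, ∃ y : ZMod p, i + 1 < p → HasResidue p (_root_.bernoulli i) y := by
    intro i
    by_cases hi : i + 1 < p
    · obtain ⟨y, hy⟩ := exists_hasResidue_bernoulli i hi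
      exact ⟨y, fun _ => hy⟩
    · exact ⟨0, fun h => absurd h hi⟩
  choose g hg using hbern
  have hgz : g (p - (s + t)) = z := (hg _ (by omega)).unique hz
  have hm0 : ((m + 1 : ℕ) : ZMod p) ≠ 0 := natCast_ne_zero_of_lt (by omega) (by omega)
  have hprefix : ∀ α ∈ Ico 1 p, ∑ β ∈ Ico 1 α, ((β : ZMod p) ^ s)⁻¹ =
      ∑ i ∈ range (m + 1), g i * ((m + 1).choose i : ℕ) * (α : ZMod p) ^ (m + 1 - i) *
        ((m + 1 : ℕ) : ZMod p)⁻¹ := by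
    intro α hα
    obtain ⟨h1, h2⟩ := mem_Ico.mp hα
    have hsum : HasResidue p (∑ k ∈ range α, (k : ℚ) ^ m) (∑ k ∈ range α, (k : ZMod p) ^ m) :=
      HasResidue.sum _ fun k _ => (HasResidue.natCast k).pow m
    have hfaul : HasResidue p (∑ k ∈ range α, (k : ℚ) ^ m)
        (∑ i ∈ range (m + 1), g i * ((m + 1).choose i : ℕ) * (α : ZMod p) ^ (m + 1 - i) *
          ((m + 1 : ℕ) : ZMod p)⁻¹) := by
      rw [sum_range_pow]
      refine HasResidue.sum _ fun i hi => ?_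
      have := mem_range.mp hi
      rw [div_eq_mul_inv, ← Nat.cast_add_one]
      exact (((hg i (by omega)).mul (HasResidue.natCast _)).mul
        ((HasResidue.natCast α).pow _)).mul (HasResidue.inv_natCast hm0)
    rw [← hsum.unique hfaul, range_eq_Ico,
      sum_eq_sum_Ico_succ_bot (show 0 < α by omega) (fun k => (k : ZMod p) ^ m), Nat.cast_zero, zero_pow (by omega), zero_add]
    refine sum_congr rfl fun β hβ => ?_
    obtain ⟨h3, h4⟩ := mem_Ico.mp hβ
    rw [inv_natCast_pow (by omega) (by omega) (by omega)]
    congr 1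
    omega
  have hswap : doubleSum p s t = ∑ i ∈ range (m + 1), g i * ((m + 1).choose i : ℕ) *
      ((m + 1 : ℕ) : ZMod p)⁻¹ * ∑ α ∈ Ico 1 p, (α : ZMod p) ^ (p - 1 - t + (m + 1 - i)) := by
    rw [doubleSum]
    simp_rw [mul_sum]
    rw [sum_comm]
    refine sum_congr rfl fun α hα => ?_
    obtain ⟨h1, h2⟩ := mem_Ico.mp hα
    rw [← mul_sum, hprefix α hα, inv_natCast_pow (by omega) (by omega) (by omega), mul_sum]
    refine sum_congr rfl fun i _ => ?_
    rw [pow_add]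
    ring
  rw [hswap, sum_eq_single (p - (s + t))]
  · rw [sum_Ico_natCast_pow, if_pos, hgz,
      show (m + 1).choose (p - (s + t)) = (p - s).choose t by
        rw [show m + 1 = p - s by omega]
        exact Nat.choose_symm_of_eq_add (by omega),
      natCast_choose_sub (by omega) ht' (by omega), show m + 1 = p - s by omega,
      natCast_sub_eq_neg (by omega), inv_neg]
    · ring
    · rw [show p - 1 - t + (m + 1 - (p - (s + t))) = p - 1 by omega]
  · intro i hi hne
    have := mem_range.mp hi
    rw [sum_Ico_natCast_pow, if_neg, mul_zero]
    rintro ⟨c, hc⟩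
    rcases c with _ | _ | c
    · omega
    · omega
    · have : (p - 1) * (c + 1 + 1) = (p - 1) * c + 2 * (p - 1) := by ring
      omega
  · intro h
    exact absurd (mem_range.mpr (by omega)) h

end DoubleSum

lemma choose_quotients_sub {F : Type*} [Field F] (a b : ℕ) (ha : ((a + 1 : ℕ) : F) ≠ 0)
    (ha' : ((2 * a + 1 : ℕ) : F) ≠ 0) (hb' : ((2 * b + 1 : ℕ) : F) ≠ 0)
    (hw : ((2 * a + 2 * b + 3 : ℕ) : F) ≠ 0) :
    ((2 * a + 1 : ℕ) : F)⁻¹ * ((2 * a + 2 * b + 2).choose (2 * b + 2) : ℕ) -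
      ((2 * b + 1 : ℕ) : F)⁻¹ * ((2 * a + 2 * b + 2).choose (2 * a + 2) : ℕ) =
    ((a : F) - b) * ((a + 1 : ℕ) : F)⁻¹ * ((2 * a + 2 * b + 3).choose (2 * b + 2) : ℕ) *
      ((2 * a + 2 * b + 3 : ℕ) : F)⁻¹ := by
  have h1 : (2 * a + 2 * b + 3) * (2 * a + 2 * b + 2).choose (2 * b + 2) =
      (2 * a + 2 * b + 3).choose (2 * b + 2) * (2 * a + 1) := by
    have := Nat.choose_mul_succ_eq (2 * a + 2 * b + 2) (2 * b + 2)
    rw [show 2 * a + 2 * b + 2 + 1 - (2 * b + 2) = 2 * a + 1 by omega] at this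
    rw [mul_comm, this]
  have h2 : (2 * a + 2 * b + 3) * (2 * a + 2 * b + 2).choose (2 * a + 2) =
      (2 * a + 2 * b + 3).choose (2 * b + 1) * (2 * b + 1) := by
    have := Nat.choose_mul_succ_eq (2 * a + 2 * b + 2) (2 * a + 2)
    rw [show 2 * a + 2 * b + 2 + 1 - (2 * a + 2) = 2 * b + 1 by omega] at this
    rw [mul_comm, this,
      Nat.choose_symm_of_eq_add (by omega : 2 * a + 2 * b + 2 + 1 = _ + (2 * b + 1))]
  have h3 : (2 * a + 2 * b + 3).choose (2 * b + 2) * (b + 1) =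
      (2 * a + 2 * b + 3).choose (2 * b + 1) * (a + 1) := by
    have := Nat.choose_succ_right_eq (2 * a + 2 * b + 3) (2 * b + 1)
    rw [show 2 * a + 2 * b + 3 - (2 * b + 1) = 2 * (a + 1) by omega] at this
    linarith
  have e1 := congrArg (Nat.cast : ℕ → F) h1
  have e2 := congrArg (Nat.cast : ℕ → F) h2
  have e3 := congrArg (Nat.cast : ℕ → F) h3
  rw [Nat.cast_mul, Nat.cast_mul] at e1 e2 e3
  have q1 : ((2 * a + 1 : ℕ) : F)⁻¹ * ((2 * a + 2 * b + 2).choose (2 * b + 2) : ℕ) =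
      ((2 * a + 2 * b + 3).choose (2 * b + 2) : ℕ) * ((2 * a + 2 * b + 3 : ℕ) : F)⁻¹ := by
    field_simp
    linear_combination e1
  have q2 : ((2 * b + 1 : ℕ) : F)⁻¹ * ((2 * a + 2 * b + 2).choose (2 * a + 2) : ℕ) =
      ((2 * a + 2 * b + 3).choose (2 * b + 1) : ℕ) * ((2 * a + 2 * b + 3 : ℕ) : F)⁻¹ := by
    field_simp
    linear_combination e2
  rw [q1, q2]
  field_simp
  push_cast at e3 ⊢
  linear_combination e3

end TruncatedMZV

open TruncatedMZV

/-- Hessami Pilehrood–Hessami Pilehrood–Tauraso: the value of `Z_p({2}^a, 3, {2}^b)` modulo `p`. -/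
theorem stmt7 (a b : ℕ) :
    ∀ᶠ p in Filter.cofinite, p.Prime →
      congrMod p 1
        (Z p (List.replicate a 2 ++ 3 :: List.replicate b 2))
        ((-1 : ℚ) ^ (a + b) * 2 * ((a : ℚ) - b) / (a + 1) *
          ((2 * a + 2 * b + 3).choose (2 * b + 2) : ℚ) *
          (bernoulli (p - (2 * a + 2 * b + 3)) / (2 * a + 2 * b + 3))) := by
  rw [Filter.eventually_cofinite]
  refine (Set.finite_lt_nat (2 * a + 2 * b + 6)).subset fun p hp => ?_
  by_contra hlarge
  apply hp
  intro hprime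
  rw [Set.mem_ofPred_eq, not_lt] at hlarge
  have : Fact p.Prime := ⟨hprime⟩
  obtain ⟨n, hn⟩ : ∃ n, p = 2 * n + 1 := hprime.odd_of_ne_two (by omega)
  obtain ⟨z, hz⟩ := exists_hasResidue_bernoulli (p := p) (p - (2 * a + 2 * b + 3)) (by omega)
  have ha : ((a + 1 : ℕ) : ZMod p) ≠ 0 := natCast_ne_zero_of_lt (by omega) (by omega)
  have hw : ((2 * a + 2 * b + 3 : ℕ) : ZMod p) ≠ 0 := natCast_ne_zero_of_lt (by omega) (by omega)
  have hlhs := hasResidue_ZAux (p := p) (N := p - 1) (by omega) a b 1 le_rfl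
  rw [Nat.sub_add_cancel (by omega), sum_coeff_genPoly_eq_halfSum_sub hn (by omega) (by omega),
    halfSum_eq_doubleSum hn (by omega) (by omega), halfSum_eq_doubleSum hn (by omega) (by omega),
    doubleSum_eq (z := z) (by omega) (by omega) (by omega) ⟨a + 1, by ring⟩
      (by rwa [show 2 * b + 1 + (2 * a + 2) = 2 * a + 2 * b + 3 by ring]),
    doubleSum_eq (z := z) (by omega) (by omega) (by omega) ⟨b + 1, by ring⟩
      (by rwa [show 2 * a + 1 + (2 * b + 2) = 2 * a + 2 * b + 3 by ring]),
    show 2 * b + 1 + (2 * a + 2) - 1 = 2 * a + 2 * b + 2 by omega,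
    show 2 * a + 1 + (2 * b + 2) - 1 = 2 * a + 2 * b + 2 by omega] at hlhs
  have hchoose := choose_quotients_sub (F := ZMod p) a b ha
    (natCast_ne_zero_of_lt (by omega) (by omega)) (natCast_ne_zero_of_lt (by omega) (by omega)) hw
  have hrhs := ((((HasResidue.intCast (p := p) ((-1) ^ (a + b) * 2 * ((a : ℤ) - b))).mul
    (HasResidue.inv_natCast ha)).mul
    (HasResidue.natCast ((2 * a + 2 * b + 3).choose (2 * b + 2)))).mul
    (hz.mul (HasResidue.inv_natCast hw)))
  refine HasResidue.congrMod_one hlhs ?_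
  convert hrhs using 1
  · push_cast
    rw [div_eq_mul_inv, div_eq_mul_inv]
  · push_cast at hchoose ⊢
    linear_combination 2 * (-1 : ZMod p) ^ (a + b) * z * hchoose
end

section
/- For non-negative integers l and m with (l,m) ≠ (0,0), for all but finitely many primes p the following congruence of rational numbers holds modulo p²: Z_p({2}^{2l+m}) + 2p · ∑_{j=0}^{l−1} Z_p({2}^{l+m+j}, 3, {2}^{l−j−1}) is congruent to (−1)^m · 2 · { 1 − 2·C(4l+2m, 2l) } · (B_{p−4l−2m−1}/(4l+2m+1)) · p modulo p², where C(n,k) denotes the binomial coefficient. (Equivalently, ζ_{𝒜₂}(({2}^{l+m}) ш ({2}^l)) = (−1)^m · 2 · {1 − 2·C(4l+2m,2l)} · β_{4l+2m+1}·𝒑 in 𝒜₂, after expanding the shuffle product via the shuffle relation.) -/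
open Finset Polynomial in
/-- The `a`-th elementary symmetric sum of `c s, …, c (t - 1)`. -/
noncomputable def elemSum {R : Type*} [CommRing R] (c : ℕ → R) (a s t : ℕ) : R :=
  (∏ j ∈ Ico s t, (1 + C (c j) * X)).coeff a

/-- `∑_{s ≤ n₁ < ⋯ < n_r < N} ∏ᵢ f(nᵢ)^{kᵢ}`, the common shape of truncated multiple zeta values
over rings in which `f n` plays the role of `1/n`. -/
def zSum {R : Type*} [CommRing R] (f : ℕ → R) (N : ℕ) : List ℕ → ℕ → R
  | [], _ => 1
  | k :: ks, s => ∑ n ∈ Finset.Ico s N, f n ^ k * zSum f N ks (n + 1)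

namespace zSum

open Finset Polynomial

section Ring

variable {R : Type*} [CommRing R]

lemma elemSum_zero (c : ℕ → R) (s t : ℕ) : elemSum c 0 s t = 1 := by
  simp [elemSum, coeff_zero_eq_eval_zero, eval_prod]

lemma elemSum_succ_of_le (c : ℕ → R) (a : ℕ) {s t : ℕ} (h : t ≤ s) :
    elemSum c (a + 1) s t = 0 := by
  simp [elemSum, Ico_eq_empty_of_le h, coeff_one]

lemma elemSum_succ_of_lt (c : ℕ → R) (a : ℕ) {s t : ℕ} (h : s < t) :
    elemSum c (a + 1) s t = elemSum c (a + 1) (s + 1) t + c s * elemSum c a (s + 1) t := by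
  rw [elemSum, prod_eq_prod_Ico_succ_bot h, add_mul, one_mul, mul_assoc, coeff_add, coeff_C_mul,
    coeff_X_mul, elemSum, elemSum]

lemma map_elemSum {S : Type*} [CommRing S] (φ : R →+* S) (c : ℕ → R) (a s t : ℕ) :
    φ (elemSum c a s t) = elemSum (fun n => φ (c n)) a s t := by
  simp [elemSum, ← coeff_map, Polynomial.map_prod]

lemma map_zSum {S : Type*} [CommRing S] (φ : R →+* S) (f : ℕ → R) (N : ℕ) (ks : List ℕ) (s : ℕ) :
    φ (zSum f N ks s) = zSum (fun n => φ (f n)) N ks s := by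
  induction ks generalizing s with
  | nil => simp [zSum]
  | cons k ks ih => simp [zSum, ih]

lemma cons_of_lt (f : ℕ → R) {s N : ℕ} (k : ℕ) (ks : List ℕ) (h : s < N) :
    zSum f N (k :: ks) s = f s ^ k * zSum f N ks (s + 1) + zSum f N (k :: ks) (s + 1) := by
  rw [zSum, sum_eq_sum_Ico_succ_bot h, zSum]

lemma cons_of_le (f : ℕ → R) {s N : ℕ} (k : ℕ) (ks : List ℕ) (h : N ≤ s) :
    zSum f N (k :: ks) s = 0 := by
  rw [zSum, Ico_eq_empty_of_le h, sum_empty]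

lemma replicate_eq_elemSum (f : ℕ → R) (N k b s : ℕ) :
    zSum f N (List.replicate b k) s = elemSum (fun n => f n ^ k) b s N := by
  induction d : N - s generalizing s b with
  | zero =>
    cases b with
    | zero => simp [zSum, elemSum_zero]
    | succ b =>
      rw [elemSum_succ_of_le _ _ (by omega), List.replicate_succ, cons_of_le _ _ _ (by omega)]
  | succ d ih =>
    cases b with
    | zero => simp [zSum, elemSum_zero]
    | succ b =>
      rw [elemSum_succ_of_lt _ _ (by omega), List.replicate_succ, cons_of_lt _ _ _ (by omega),
        ih b (s + 1) (by omega), ← List.replicate_succ, ih (b + 1) (s + 1) (by omega), add_comm]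

lemma replicate_append (f : ℕ → R) (N k a r s : ℕ) (ks : List ℕ) :
    zSum f N (List.replicate a k ++ r :: ks) s =
      ∑ n ∈ Ico s N, elemSum (fun n => f n ^ k) a s n * (f n ^ r * zSum f N ks (n + 1)) := by
  induction d : N - s generalizing s a with
  | zero =>
    rw [Ico_eq_empty_of_le (by omega), sum_empty]
    cases a with
    | zero => exact cons_of_le _ _ _ (by omega)
    | succ a => rw [List.replicate_succ, List.cons_append, cons_of_le _ _ _ (by omega)]
  | succ d ih =>
    cases a with
    | zero => simp [zSum, elemSum_zero]
    | succ a =>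
      rw [List.replicate_succ, List.cons_append, cons_of_lt _ _ _ (by omega),
        ih a (s + 1) (by omega), ← List.cons_append, ← List.replicate_succ,
        ih (a + 1) (s + 1) (by omega), sum_eq_sum_Ico_succ_bot (a := s) (by omega),
        elemSum_succ_of_le _ _ le_rfl, zero_mul, zero_add, mul_sum, ← sum_add_distrib]
      refine sum_congr rfl fun n hn => ?_
      rw [elemSum_succ_of_lt (s := s) _ _ (by simp at hn; omega)]
      ring

end Ring

section Field

variable {K : Type*} [Field K]

/-- `∏_{s ≤ j < t} (1 - x²/j²)`. -/
def sinProd (x : K) (s t : ℕ) : K := ∏ j ∈ Ico s t, (1 - x ^ 2 / (j : K) ^ 2)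

lemma sinProd_eq_zero {j s t : ℕ} (hj : j ∈ Ico s t) (h0 : (j : K) ≠ 0) :
    sinProd (j : K) s t = 0 :=
  prod_eq_zero hj (by rw [div_self (pow_ne_zero 2 h0), sub_self])

/-- The telescoping sum `∑_n n⁻² P_{n-1}(x) D_n(y)`. -/
lemma sum_inv_sq_mul_sinProd (h : ℕ) (h0 : ∀ j ∈ Ico 1 (h + 1), (j : K) ≠ 0) (x y : K) :
    (y ^ 2 - x ^ 2) * ∑ n ∈ Ico 1 (h + 1),
        ((n : K) ^ 2)⁻¹ * sinProd x 1 n * sinProd y (n + 1) (h + 1) =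
      sinProd x 1 (h + 1) - sinProd y 1 (h + 1) := by
  have := sum_Ico_sub (fun n => sinProd x 1 n * sinProd y n (h + 1)) (m := 1) (n := h + 1)
    (by omega)
  simp only [sinProd, Ico_self, prod_empty, mul_one, one_mul] at this ⊢
  rw [← this, mul_sum]
  refine sum_congr rfl fun n hn => ?_
  have hn0 := h0 n hn
  rw [mem_Ico] at hn
  rw [prod_Ico_succ_top hn.1, prod_eq_prod_Ico_succ_bot hn.2]
  field_simp
  ring

lemma sinProd_add_one (x : K) {n : ℕ} (hn : 1 ≤ n) (h0 : ∀ j ∈ Ico 1 n, (j : K) ≠ 0) :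
    (x + 1) * (x + 1 - n) * sinProd (x + 1) 1 n = x * (x + n) * sinProd x 1 n := by
  induction n, hn using Nat.le_induction with
  | base => simp [sinProd]; ring
  | succ n hn ih =>
    have ih := ih fun j hj => h0 j (by simp at hj ⊢; omega)
    have hn0 := h0 n (by simp; omega)
    unfold sinProd at ih ⊢
    rw [prod_Ico_succ_top hn, prod_Ico_succ_top hn]
    push_cast
    field_simp
    linear_combination (-(n + x + 1) * (x - n)) * ih

lemma sum_inv_cube_mul_sinProd_add_one (h : ℕ) (h0 : ∀ j ∈ Ico 1 (h + 1), (j : K) ≠ 0) (x y : K) :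
    (x + 1) ^ 2 * ∑ n ∈ Ico 1 (h + 1),
        ((n : K) ^ 3)⁻¹ * sinProd (x + 1) 1 n * sinProd y (n + 1) (h + 1) =
      x ^ 2 * ∑ n ∈ Ico 1 (h + 1),
        ((n : K) ^ 3)⁻¹ * sinProd x 1 n * sinProd y (n + 1) (h + 1) +
      x * ∑ n ∈ Ico 1 (h + 1),
        ((n : K) ^ 2)⁻¹ * sinProd x 1 n * sinProd y (n + 1) (h + 1) +
      (x + 1) * ∑ n ∈ Ico 1 (h + 1),
        ((n : K) ^ 2)⁻¹ * sinProd (x + 1) 1 n * sinProd y (n + 1) (h + 1) := by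
  simp only [mul_sum, ← sum_add_distrib]
  refine sum_congr rfl fun n hn => ?_
  have hn0 := h0 n hn
  have := sinProd_add_one x (mem_Ico.1 hn).1 fun j hj => h0 j (by simp at hj hn ⊢; omega)
  field_simp
  linear_combination sinProd y (n + 1) (h + 1) * this

/-- The closed form of `s² ∑_n n⁻³ P_{n-1}(s) D_n(k)` at integers `1 ≤ s, k ≤ h`. -/
lemma sum_inv_cube_mul_sinProd (h : ℕ) (h0 : ∀ j ∈ Ico 1 (h + 1), (j : K) ≠ 0)
    (hsub : ∀ r ∈ Ico 1 (h + 1), ∀ k ∈ Ico 1 (h + 1), r ≠ k → (k : K) ^ 2 - (r : K) ^ 2 ≠ 0)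
    {s k : ℕ} (hs : s ≤ h) (hk : k ∈ Ico 1 (h + 1)) :
    (s : K) ^ 2 * ∑ n ∈ Ico 1 (h + 1),
        ((n : K) ^ 3)⁻¹ * sinProd (s : K) 1 n * sinProd (k : K) (n + 1) (h + 1) =
      (if s < k then 0 else if s = k then 1 else 2) *
        ((k : K)⁻¹ * sinProd (k : K) 1 k * sinProd (k : K) (k + 1) (h + 1)) := by
  have key : ∀ r ≤ h, (r : K) * ∑ n ∈ Ico 1 (h + 1),
      ((n : K) ^ 2)⁻¹ * sinProd (r : K) 1 n * sinProd (k : K) (n + 1) (h + 1) =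
      if r = k then (k : K)⁻¹ * sinProd (k : K) 1 k * sinProd (k : K) (k + 1) (h + 1) else 0 := by
    intro r hr
    rcases Nat.eq_zero_or_pos r with rfl | hr1
    · simp at hk
      rw [if_neg (by omega)]; simp
    have hr' : r ∈ Ico 1 (h + 1) := by simp; omega
    split_ifs with hrk
    · subst hrk
      rw [sum_eq_single_of_mem r hr']
      · have := h0 r hr'
        field_simp
      · intro n hn hne
        rcases Nat.lt_or_gt_of_ne hne with hlt | hlt
        · rw [sinProd_eq_zero (s := n + 1) (by simp at hr' ⊢; omega) (h0 r hr'), mul_zero]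
        · rw [sinProd_eq_zero (s := 1) (by simp at hr' ⊢; omega) (h0 r hr'), mul_zero, zero_mul]
    · have := sum_inv_sq_mul_sinProd h h0 (r : K) (k : K)
      rw [sinProd_eq_zero hr' (h0 r hr'), sinProd_eq_zero hk (h0 k hk), sub_self,
        mul_eq_zero] at this
      rw [this.resolve_left (hsub r hr' k hk hrk), mul_zero]
  induction s with
  | zero => simp at hk ⊢; omega
  | succ s ih =>
    have e1 := key s (by omega)
    have e2 := key (s + 1) hs
    rw [Nat.cast_succ] at e2 ⊢
    rw [sum_inv_cube_mul_sinProd_add_one h h0, ih (by omega), e1, e2]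
    split_ifs <;> first | omega | ring

end Field

section Reflect

/-- Folding a sum over `1, …, p - 1` onto `1, …, h` when `p = 2h + 1`. -/
lemma sum_Ico_fold {M : Type*} [AddCommMonoid M] {p h : ℕ} (hp : p = 2 * h + 1) (F : ℕ → M) :
    ∑ n ∈ Ico 1 p, F n = ∑ n ∈ Ico 1 (h + 1), (F n + F (p - n)) := by
  rw [← sum_Ico_consecutive F (show 1 ≤ h + 1 by omega) (show h + 1 ≤ p by omega),
    sum_add_distrib, sum_Ico_reflect F 1 (by omega)]
  congr 3
  omega

lemma elemSum_reflect {R : Type*} [CommRing R] {c : ℕ → R} {p : ℕ}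
    (hc : ∀ j ∈ Ico 1 p, c (p - j) = c j) (a : ℕ) {s t : ℕ} (hs : 1 ≤ s) (ht : t ≤ p) :
    elemSum c a (p + 1 - t) (p + 1 - s) = elemSum c a s t := by
  rw [elemSum, elemSum, ← prod_Ico_reflect (fun j => 1 + C (c j) * X) s (by omega : t ≤ p + 1)]
  congr 1
  exact prod_congr rfl fun j hj => by rw [hc j (by simp at hj ⊢; omega)]

lemma elemSum_neg {R : Type*} [CommRing R] (c : ℕ → R) (a s t : ℕ) :
    elemSum (fun n => -c n) a s t = (-1) ^ a * elemSum c a s t := by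
  have := comp_C_mul_X_coeff (p := ∏ j ∈ Ico s t, (1 + C (c j) * X)) (r := -1) (n := a)
  rw [elemSum, elemSum, mul_comm, ← this, Polynomial.prod_comp]
  simp

end Reflect

section ZMod

variable {p : ℕ} [Fact p.Prime]

lemma natCast_ne_zero {j : ℕ} (hj : j ∈ Ico 1 p) : (j : ZMod p) ≠ 0 := by
  rw [mem_Ico] at hj
  rw [Ne, ZMod.natCast_eq_zero_iff]
  exact Nat.not_dvd_of_pos_of_lt hj.1 hj.2

lemma natCast_reflect {j : ℕ} (hj : j ∈ Ico 1 p) : ((p - j : ℕ) : ZMod p) = -j := by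
  rw [Nat.cast_sub (mem_Ico.1 hj).2.le]
  simp

lemma sum_pow_eq (e : ℕ) :
    ∑ v ∈ Ico 1 p, (v : ZMod p) ^ e = if p - 1 ∣ e then -1 else 0 := by
  have hu := FiniteField.sum_pow_units (ZMod p) e
  rw [ZMod.card] at hu
  rw [← hu]
  exact sum_bij'
    (fun v hv => Units.mk0 (v : ZMod p) (natCast_ne_zero hv))
    (fun u _ => (u : ZMod p).val)
    (fun _ _ => mem_univ _)
    (fun u _ => by grind [u.ne_zero, ZMod.val_ne_zero, ZMod.val_lt])
    (fun v hv => by simp [ZMod.val_cast_of_lt (mem_Ico.mp hv).2])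
    (fun u _ => Units.ext (ZMod.natCast_zmod_val _))
    (fun _ _ => rfl)

variable {h : ℕ}

lemma two_mul_natCast_half (hp : p = 2 * h + 1) : (2 : ZMod p) * h = -1 := by
  have : ((2 * h + 1 : ℕ) : ZMod p) = 0 := by rw [← hp]; simp
  push_cast at this
  linear_combination this

lemma two_ne_zero_of_odd (hp : p = 2 * h + 1) : (2 : ZMod p) ≠ 0 := by
  intro h2
  simpa [h2] using two_mul_natCast_half hp

lemma half_ne_zero (hp : p = 2 * h + 1) : (h : ZMod p) ≠ 0 := by
  intro h2
  simpa [h2] using two_mul_natCast_half hp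

lemma sum_sq_pow_half (hp : p = 2 * h + 1) (e : ℕ) :
    ∑ s ∈ Ico 1 (h + 1), ((s : ZMod p) ^ 2) ^ e = if h ∣ e then (h : ZMod p) else 0 := by
  have h1 := sum_pow_eq (p := p) (2 * e)
  rw [sum_Ico_fold hp] at h1
  apply mul_left_cancel₀ (two_ne_zero_of_odd hp)
  have h2 : ∀ s ∈ Ico 1 (h + 1), (s : ZMod p) ^ (2 * e) + ((p - s : ℕ) : ZMod p) ^ (2 * e) =
      2 * ((s : ZMod p) ^ 2) ^ e := fun s hs => by
    rw [natCast_reflect (by simp at hs ⊢; omega), (even_two_mul e).neg_pow, pow_mul]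
    ring
  rw [sum_congr rfl h2, ← mul_sum] at h1
  rw [h1, mul_ite, two_mul_natCast_half hp, mul_zero]
  simp only [show p - 1 = 2 * h by omega, Nat.mul_dvd_mul_iff_left two_pos]

lemma sq_pow_half (hp : p = 2 * h + 1) {s : ℕ} (hs : s ∈ Ico 1 p) :
    ((s : ZMod p) ^ 2) ^ h = 1 := by
  rw [← pow_mul, show 2 * h = p - 1 by omega, ZMod.pow_card_sub_one_eq_one (natCast_ne_zero hs)]

/-- Coefficients of a low-degree polynomial from its values at the nonzero squares. -/
lemma sum_inv_sq_pow_mul_eval (hp : p = 2 * h + 1) {q : (ZMod p)[X]} (hq : q.natDegree < h)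
    {a : ℕ} (ha : a < h) :
    ∑ s ∈ Ico 1 (h + 1), (((s : ZMod p) ^ 2)⁻¹) ^ a * q.eval ((s : ZMod p) ^ 2) =
      h * q.coeff a := by
  have h1 : ∀ s ∈ Ico 1 (h + 1), (((s : ZMod p) ^ 2)⁻¹) ^ a * q.eval ((s : ZMod p) ^ 2) =
      ∑ i ∈ range h, q.coeff i * ((s : ZMod p) ^ 2) ^ (i + (h - a)) := fun s hs => by
    have hs' : s ∈ Ico 1 p := by simp at hs ⊢; omega
    have h0 := natCast_ne_zero hs'
    rw [eval_eq_sum_range' hq, mul_sum]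
    refine sum_congr rfl fun i _ => ?_
    have : (((s : ZMod p) ^ 2)⁻¹) ^ a = ((s : ZMod p) ^ 2) ^ (h - a) := by
      rw [inv_pow]
      apply inv_eq_of_mul_eq_one_right
      rw [← pow_add, Nat.add_sub_cancel' ha.le, sq_pow_half hp hs']
    rw [this, pow_add]
    ring
  rw [sum_congr rfl h1, sum_comm]
  simp_rw [← mul_sum, sum_sq_pow_half hp]
  rw [sum_eq_single_of_mem a (mem_range.2 ha)]
  · rw [Nat.add_sub_cancel' ha.le, if_pos dvd_rfl, mul_comm]
  · intro i hi hne
    rw [if_neg, mul_zero]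
    rintro ⟨c, hc⟩
    rw [mem_range] at hi
    have hc1 : 0 < c := by
      rcases Nat.eq_zero_or_pos c with rfl | hc1
      · omega
      · exact hc1
    have hc2 : c < 2 := by
      by_contra! hcon
      have := Nat.mul_le_mul_left h hcon
      omega
    obtain rfl : c = 1 := by omega
    omega

lemma sq_sub_sq_ne_zero (hp : p = 2 * h + 1) :
    ∀ r ∈ Ico 1 (h + 1), ∀ k ∈ Ico 1 (h + 1), r ≠ k → (k : ZMod p) ^ 2 - (r : ZMod p) ^ 2 ≠ 0 := by
  intro r hr k hk hne
  rw [mem_Ico] at hr hk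
  rw [sq_sub_sq]
  refine mul_ne_zero ?_ ?_
  · rw [← Nat.cast_add]
    exact natCast_ne_zero (by simp; omega)
  · rw [sub_ne_zero, Ne, ZMod.natCast_eq_natCast_iff', Nat.mod_eq_of_lt (by omega),
      Nat.mod_eq_of_lt (by omega)]
    exact hne.symm

lemma prod_one_sub_half (hp : p = 2 * h + 1) :
    ∏ j ∈ Ico 1 (h + 1), (1 + C (-((j : ZMod p) ^ 2)⁻¹) * X) = 1 - X ^ h := by
  have hh : 0 < h := by
    rcases Nat.eq_zero_or_pos h with rfl | hh
    · exact absurd hp (Fact.out : p.Prime).ne_one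
    · exact hh
  have hinj : Set.InjOn (fun s : ℕ => (s : ZMod p) ^ 2) (range (h + 1)) := by
    intro r hr k hk hrk
    simp only [coe_range, Set.mem_Iio] at hr hk
    by_contra hne
    rcases Nat.eq_zero_or_pos r with rfl | hr0
    · exact natCast_ne_zero (p := p) (j := k) (by simp; omega) (by simpa using hrk.symm)
    rcases Nat.eq_zero_or_pos k with rfl | hk0
    · exact natCast_ne_zero (p := p) (j := r) (by simp; omega) (by simpa using hrk)
    exact sq_sub_sq_ne_zero hp r (by simp; omega) k (by simp; omega) hne
      (sub_eq_zero.2 hrk.symm)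
  refine eq_of_degree_sub_lt_of_eval_finset_eq ((range (h + 1)).image fun s : ℕ => (s : ZMod p) ^ 2)
    ?_ ?_
  · rw [card_image_of_injOn hinj, card_range]
    refine (degree_sub_le _ _).trans_lt (max_lt ?_ ?_)
    · refine (degree_prod_le _ _).trans_lt ((sum_le_card_nsmul _ _ 1 fun j _ => ?_).trans_lt ?_)
      · compute_degree
      · simp
        exact_mod_cast Nat.lt_succ_self h
    · refine (degree_sub_le _ _).trans_lt (max_lt ?_ ?_)
      · exact degree_one_le.trans_lt (by exact_mod_cast Nat.succ_pos h)
      · rw [degree_X_pow]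
        exact_mod_cast Nat.lt_succ_self h
  · intro x hx
    obtain ⟨s, hs, rfl⟩ := mem_image.1 hx
    rw [mem_range] at hs
    rcases Nat.eq_zero_or_pos s with rfl | hs0
    · simp [eval_prod, hh.ne']
    have hs' : s ∈ Ico 1 p := by simp; omega
    have h0 := natCast_ne_zero hs'
    rw [eval_prod, prod_eq_zero (i := s) (by simp; omega)]
    · simp [sq_pow_half hp hs']
    · simp [h0]

lemma elemSum_inv_sq_upper (hp : p = 2 * h + 1) {b n : ℕ} (hb : b < h) (hn : n ≤ h) :
    elemSum (fun j => -((j : ZMod p) ^ 2)⁻¹) b (n + 1) p =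
      elemSum (fun j => -((j : ZMod p) ^ 2)⁻¹) b (n + 1) (h + 1) := by
  have h1 : ∏ j ∈ Ico (h + 1) p, (1 + C (-((j : ZMod p) ^ 2)⁻¹) * X) = 1 - X ^ h := by
    rw [← prod_one_sub_half hp]
    have h2 := prod_Ico_reflect (fun j => 1 + C (-((j : ZMod p) ^ 2)⁻¹) * X) (h + 1)
      (show p ≤ p + 1 by omega)
    rw [show p + 1 - p = 1 by omega, show p + 1 - (h + 1) = h + 1 by omega] at h2
    rw [← h2]
    refine prod_congr rfl fun j hj => ?_
    rw [natCast_reflect (by simp at hj ⊢; omega), neg_sq]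
  rw [elemSum, ← prod_Ico_consecutive _ (show n + 1 ≤ h + 1 by omega) (show h + 1 ≤ p by omega), h1,
    mul_sub, mul_one, coeff_sub, coeff_mul_X_pow', if_neg (by omega), sub_zero, elemSum]

lemma natDegree_prod_lt {K : Type*} [Field K] (c : ℕ → K) {s t : ℕ} (hst : t - s < h) :
    (∏ j ∈ Ico s t, (1 + C (c j) * X)).natDegree < h := by
  refine ((natDegree_prod_le _ _).trans (sum_le_card_nsmul _ _ 1 fun j _ => ?_)).trans_lt ?_
  · compute_degree
  · simpa using hst

lemma half_mul_elemSum (hp : p = 2 * h + 1) {a s t : ℕ} (ha : a < h) (hst : t - s < h) :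
    h * elemSum (fun j => -((j : ZMod p) ^ 2)⁻¹) a s t =
      ∑ r ∈ Ico 1 (h + 1), (((r : ZMod p) ^ 2)⁻¹) ^ a * sinProd (r : ZMod p) s t := by
  rw [elemSum, ← sum_inv_sq_pow_mul_eval hp (natDegree_prod_lt _ hst) ha]
  refine sum_congr rfl fun r _ => ?_
  rw [eval_prod, sinProd]
  congr 1
  refine prod_congr rfl fun j _ => ?_
  simp
  ring

lemma sinProd_mul_sinProd (hp : p = 2 * h + 1) {k : ℕ} (hk : k ∈ Ico 1 (h + 1)) :
    sinProd (k : ZMod p) 1 k * sinProd (k : ZMod p) (k + 1) (h + 1) = h := by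
  have hk' : k ∈ Ico 1 p := by simp at hk ⊢; omega
  have h0 := natCast_ne_zero hk'
  have hfac := prod_one_sub_half hp
  rw [mem_Ico] at hk
  rw [← prod_Ico_consecutive _ hk.1 hk.2.le, prod_eq_prod_Ico_succ_bot hk.2] at hfac
  have hd := congrArg (fun q => (derivative q).eval ((k : ZMod p) ^ 2)) hfac
  simp only [derivative_mul, derivative_add, derivative_sub, derivative_one,
    derivative_X, derivative_X_pow, eval_add, eval_mul, eval_sub, eval_C, eval_X, eval_one,
    eval_prod, eval_pow, neg_mul, inv_mul_cancel₀ (pow_ne_zero 2 h0), eval_neg, map_neg,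
    derivative_C, eval_zero, add_neg_cancel] at hd
  have h3 : ∀ s t : ℕ, ∏ j ∈ Ico s t, (1 + -(((j : ZMod p) ^ 2)⁻¹ * (k : ZMod p) ^ 2)) =
      sinProd (k : ZMod p) s t := fun s t => prod_congr rfl fun j _ => by ring
  rw [h3, h3] at hd
  have h4 : ((k : ZMod p) ^ 2) ^ (h - 1) * (k : ZMod p) ^ 2 = 1 := by
    rw [← pow_succ, Nat.sub_add_cancel (by omega), sq_pow_half hp hk']
  linear_combination (-(k : ZMod p) ^ 2) * hd + (h : ZMod p) * h4 -
    sinProd (k : ZMod p) 1 k * sinProd (k : ZMod p) (k + 1) (h + 1) *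
      inv_mul_cancel₀ (pow_ne_zero 2 h0)

/-- The part `n ≤ h` of the truncated sum for `({2}^a, 3, {2}^b)` modulo `p = 2h + 1`. -/
lemma sum_half_elemSum (hp : p = 2 * h + 1) {a b : ℕ} (ha : a < h) (hb : b < h) :
    (-1) ^ (a + b) * ∑ n ∈ Ico 1 (h + 1), elemSum (fun j => ((j : ZMod p)⁻¹) ^ 2) a 1 n *
        (((n : ZMod p)⁻¹) ^ 3 * elemSum (fun j => ((j : ZMod p)⁻¹) ^ 2) b (n + 1) p) =
      -2 * ∑ s ∈ Ico 1 (h + 1), ((s : ZMod p)⁻¹) ^ (2 * a + 2) *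
        (2 * ∑ k ∈ Ico 1 s, ((k : ZMod p)⁻¹) ^ (2 * b + 1) +
          ((s : ZMod p)⁻¹) ^ (2 * b + 1)) := by
  have h0 : ∀ j ∈ Ico 1 (h + 1), (j : ZMod p) ≠ 0 := fun j hj =>
    natCast_ne_zero (by simp at hj ⊢; omega)
  have hc : ∀ a s t, (-1) ^ a * elemSum (fun j => ((j : ZMod p)⁻¹) ^ 2) a s t =
      elemSum (fun j => -((j : ZMod p) ^ 2)⁻¹) a s t := fun a s t => by
    simp only [← inv_pow]
    rw [elemSum_neg]
  have h1 : (h : ZMod p) ^ 2 * ((-1) ^ (a + b) *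
      ∑ n ∈ Ico 1 (h + 1), elemSum (fun j => ((j : ZMod p)⁻¹) ^ 2) a 1 n *
        (((n : ZMod p)⁻¹) ^ 3 * elemSum (fun j => ((j : ZMod p)⁻¹) ^ 2) b (n + 1) p)) =
      ∑ s ∈ Ico 1 (h + 1), ∑ k ∈ Ico 1 (h + 1), (((s : ZMod p) ^ 2)⁻¹) ^ a *
        (((k : ZMod p) ^ 2)⁻¹) ^ b * ∑ n ∈ Ico 1 (h + 1),
          ((n : ZMod p) ^ 3)⁻¹ * sinProd (s : ZMod p) 1 n * sinProd (k : ZMod p) (n + 1) (h + 1) := by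
    simp_rw [mul_sum]
    rw [sum_congr rfl fun s _ => sum_comm, sum_comm]
    refine sum_congr rfl fun n hn => ?_
    rw [mem_Ico] at hn
    have e1 := half_mul_elemSum hp ha (show n - 1 < h by omega)
    have e2 := half_mul_elemSum hp hb (show h + 1 - (n + 1) < h by omega)
    rw [← hc] at e1
    rw [← elemSum_inv_sq_upper hp hb (by omega), ← hc] at e2
    trans ((n : ZMod p) ^ 3)⁻¹ * ((∑ r ∈ Ico 1 (h + 1), (((r : ZMod p) ^ 2)⁻¹) ^ a *
      sinProd (r : ZMod p) 1 n) * ∑ r ∈ Ico 1 (h + 1), (((r : ZMod p) ^ 2)⁻¹) ^ b *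
      sinProd (r : ZMod p) (n + 1) (h + 1))
    · rw [← e1, ← e2, inv_pow]
      ring
    · rw [sum_mul_sum, mul_sum]
      refine sum_congr rfl fun s _ => ?_
      rw [mul_sum]
      exact sum_congr rfl fun k _ => by ring
  have h2 : ∀ s ∈ Ico 1 (h + 1), ∑ k ∈ Ico 1 (h + 1), (((s : ZMod p) ^ 2)⁻¹) ^ a *
        (((k : ZMod p) ^ 2)⁻¹) ^ b * ∑ n ∈ Ico 1 (h + 1),
          ((n : ZMod p) ^ 3)⁻¹ * sinProd (s : ZMod p) 1 n * sinProd (k : ZMod p) (n + 1) (h + 1) =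
      h * (((s : ZMod p)⁻¹) ^ (2 * a + 2) * (2 * ∑ k ∈ Ico 1 s, ((k : ZMod p)⁻¹) ^ (2 * b + 1) +
          ((s : ZMod p)⁻¹) ^ (2 * b + 1))) := by
    intro s hs
    have hs0 := h0 s hs
    have h3 : ∀ k ∈ Ico 1 (h + 1), (((s : ZMod p) ^ 2)⁻¹) ^ a *
        (((k : ZMod p) ^ 2)⁻¹) ^ b * ∑ n ∈ Ico 1 (h + 1),
          ((n : ZMod p) ^ 3)⁻¹ * sinProd (s : ZMod p) 1 n * sinProd (k : ZMod p) (n + 1) (h + 1) =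
        (if s < k then 0 else if s = k then 1 else 2) *
          (h * ((s : ZMod p)⁻¹) ^ (2 * a + 2) * ((k : ZMod p)⁻¹) ^ (2 * b + 1)) := by
      intro k hk
      have e := sum_inv_cube_mul_sinProd h h0 (sq_sub_sq_ne_zero hp) (s := s)
        (by simp at hs; omega) hk
      rw [mul_assoc (k : ZMod p)⁻¹, sinProd_mul_sinProd hp hk] at e
      have e' := congrArg (fun x => ((s : ZMod p) ^ 2)⁻¹ * x) e
      simp only [inv_mul_cancel_left₀ (pow_ne_zero 2 hs0)] at e'
      rw [e']
      simp only [← inv_pow]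
      ring
    rw [mem_Ico] at hs
    rw [sum_congr rfl h3, ← sum_Ico_consecutive _ hs.1 hs.2.le, sum_eq_sum_Ico_succ_bot hs.2]
    rw [sum_congr rfl fun k hk => by
      rw [if_neg (show ¬ s < k by simp at hk; omega), if_neg (show ¬ s = k by simp at hk; omega)]]
    rw [sum_eq_zero (s := Ico (s + 1) (h + 1)) fun k hk => by
      rw [if_pos (show s < k by simp at hk; omega), zero_mul]]
    rw [if_neg (lt_irrefl s), if_pos rfl, ← mul_sum, ← mul_sum]
    ring
  rw [sum_congr rfl h2, ← mul_sum] at h1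
  apply mul_left_cancel₀ (pow_ne_zero 2 (half_ne_zero hp))
  rw [h1]
  linear_combination ((h : ZMod p) * ∑ s ∈ Ico 1 (h + 1), ((s : ZMod p)⁻¹) ^ (2 * a + 2) *
        (2 * ∑ k ∈ Ico 1 s, ((k : ZMod p)⁻¹) ^ (2 * b + 1) +
          ((s : ZMod p)⁻¹) ^ (2 * b + 1))) * two_mul_natCast_half hp

/-- A full-range double sum in terms of a half-range one. -/
lemma sum_sum_inv_pow_fold (hp : p = 2 * h + 1) {u v : ℕ} (hu : Even u) (hv : Odd v) :
    ∑ s ∈ Ico 1 p, ((s : ZMod p)⁻¹) ^ u * ∑ k ∈ Ico 1 s, ((k : ZMod p)⁻¹) ^ v =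
      ∑ s ∈ Ico 1 (h + 1), ((s : ZMod p)⁻¹) ^ u *
        (2 * ∑ k ∈ Ico 1 s, ((k : ZMod p)⁻¹) ^ v + ((s : ZMod p)⁻¹) ^ v) := by
  have hrefl : ∀ j ∈ Ico 1 p, (((p - j : ℕ) : ZMod p)⁻¹) ^ v = -((j : ZMod p)⁻¹) ^ v :=
    fun j hj => by rw [natCast_reflect hj, inv_neg, hv.neg_pow]
  have htot : ∑ k ∈ Ico 1 p, ((k : ZMod p)⁻¹) ^ v = 0 := by
    rw [sum_Ico_fold hp]
    exact sum_eq_zero fun k hk => by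
      rw [hrefl k (by simp at hk ⊢; omega), add_neg_cancel]
  rw [sum_Ico_fold hp]
  refine sum_congr rfl fun s hs => ?_
  rw [mem_Ico] at hs
  have hsp : s ∈ Ico 1 p := by simp; omega
  rw [natCast_reflect hsp, inv_neg, hu.neg_pow, ← mul_add]
  congr 1
  have h1 : ∑ k ∈ Ico 1 (p - s), ((k : ZMod p)⁻¹) ^ v =
      -∑ k ∈ Ico (s + 1) p, ((k : ZMod p)⁻¹) ^ v := by
    have h4 := sum_Ico_reflect (fun k => ((k : ZMod p)⁻¹) ^ v) (s + 1) (n := p) (m := p)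
      (show p ≤ p + 1 by omega)
    rw [show p + 1 - p = 1 by omega, show p + 1 - (s + 1) = p - s by omega] at h4
    rw [← h4, ← sum_neg_distrib]
    exact sum_congr rfl fun k hk => hrefl k (by simp at hk ⊢; omega)
  rw [h1]
  have h5 := sum_Ico_consecutive (fun k => ((k : ZMod p)⁻¹) ^ v) (show 1 ≤ s + 1 by omega)
    (show s + 1 ≤ p by omega)
  rw [htot, sum_Ico_succ_top hs.1] at h5
  linear_combination -h5

/-- The truncated value of `({2}^a, 3, {2}^b)` modulo `p` in terms of double sums. -/
lemma zSum_replicate_three_replicate (hp : p = 2 * h + 1) {a b : ℕ} (ha : a < h) (hb : b < h) :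
    (-1) ^ (a + b) *
        zSum (fun n => (n : ZMod p)⁻¹) p (List.replicate a 2 ++ 3 :: List.replicate b 2) 1 =
      -2 * (∑ s ∈ Ico 1 p, ((s : ZMod p)⁻¹) ^ (2 * a + 2) *
          ∑ k ∈ Ico 1 s, ((k : ZMod p)⁻¹) ^ (2 * b + 1) -
        ∑ s ∈ Ico 1 p, ((s : ZMod p)⁻¹) ^ (2 * b + 2) *
          ∑ k ∈ Ico 1 s, ((k : ZMod p)⁻¹) ^ (2 * a + 1)) := by
  have hc : ∀ j ∈ Ico 1 p, (((p - j : ℕ) : ZMod p)⁻¹) ^ 2 = ((j : ZMod p)⁻¹) ^ 2 :=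
    fun j hj => by rw [natCast_reflect hj, inv_neg, neg_sq]
  rw [sum_sum_inv_pow_fold hp (by simp [parity_simps]) (by simp [parity_simps]),
    sum_sum_inv_pow_fold hp (by simp [parity_simps]) (by simp [parity_simps]), mul_sub,
    ← sum_half_elemSum hp ha hb, ← sum_half_elemSum hp hb ha, add_comm b a, ← mul_sub,
    ← sum_sub_distrib, replicate_append, sum_Ico_fold hp]
  congr 1
  refine sum_congr rfl fun n hn => ?_
  have hn' : n ∈ Ico 1 p := by simp at hn ⊢; omega
  rw [mem_Ico] at hn hn'
  have e1 := elemSum_reflect (c := fun j => ((j : ZMod p)⁻¹) ^ 2) hc a (s := n + 1) (t := p) (by omega) le_rfl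
  have e2 := elemSum_reflect (c := fun j => ((j : ZMod p)⁻¹) ^ 2) hc b (s := 1) (t := n) le_rfl (by omega)
  rw [show p + 1 - p = 1 by omega, show p + 1 - (n + 1) = p - n by omega] at e1
  rw [show p + 1 - 1 = p by omega, show p + 1 - n = p - n + 1 by omega] at e2
  rw [replicate_eq_elemSum, replicate_eq_elemSum, e1, e2, natCast_reflect (mem_Ico.2 hn'), inv_neg]
  ring

end ZMod

/-- `B` satisfies Faulhaber's formula modulo `p` for all small exponents. -/
def IsFaulhaber (p : ℕ) (B : ℕ → ZMod p) : Prop :=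
  ∀ m, m + 1 < p → ∀ n : ℕ, ((m : ZMod p) + 1) * ∑ k ∈ range n, (k : ZMod p) ^ m =
    ∑ i ∈ range (m + 1), B i * ((m + 1).choose i : ZMod p) * (n : ZMod p) ^ (m + 1 - i)

section Double

variable {p : ℕ} [Fact p.Prime]

lemma inv_pow_eq_pow {k v : ℕ} (hk : k ∈ Ico 1 p) (hv : v ≤ p - 1) :
    ((k : ZMod p)⁻¹) ^ v = (k : ZMod p) ^ (p - 1 - v) := by
  have h0 := natCast_ne_zero hk
  have h1 := ZMod.pow_card_sub_one_eq_one h0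
  rw [← Nat.sub_add_cancel hv, pow_add] at h1
  rw [inv_pow]
  exact inv_eq_of_mul_eq_one_left h1

lemma natCast_sub_eq_neg {j : ℕ} (hj : j ≤ p) : ((p - j : ℕ) : ZMod p) = -j := by
  rw [Nat.cast_sub hj]
  simp

lemma choose_sub_eq {u v : ℕ} (hv : 0 < v) (h : u + v ≤ p) :
    ((p - v).choose u : ZMod p) = (-1) ^ u * ((u + v - 1).choose u : ZMod p) := by
  induction u with
  | zero => simp
  | succ u ih =>
    have h0 : ((u + 1 : ℕ) : ZMod p) ≠ 0 := natCast_ne_zero (by simp; omega)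
    have e1 := congrArg (Nat.cast : ℕ → ZMod p) (Nat.choose_succ_right_eq (p - v) u)
    have e2 := congrArg (Nat.cast : ℕ → ZMod p) (Nat.add_one_mul_choose_eq (u + v - 1) u)
    rw [Nat.sub_sub, add_comm v u, Nat.cast_mul, Nat.cast_mul, ih (by omega),
      natCast_sub_eq_neg (by omega)] at e1
    rw [show u + v - 1 + 1 = u + v by omega, Nat.cast_mul, Nat.cast_mul] at e2
    apply mul_right_cancel₀ h0
    rw [e1, show u + 1 + v - 1 = u + v by omega, pow_succ]
    linear_combination (-1) ^ (u + 1) * e2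

lemma sum_sum_inv_pow {B : ℕ → ZMod p} (hB : IsFaulhaber p B) {u v : ℕ} (hu : Even u) (hu0 : 0 < u)
    (hv : 0 < v) (h : u + v + 1 < p) :
    ((u + v : ℕ) : ZMod p) * ∑ s ∈ Ico 1 p, ((s : ZMod p)⁻¹) ^ u *
        ∑ k ∈ Ico 1 s, ((k : ZMod p)⁻¹) ^ v =
      ((u + v).choose u : ZMod p) * B (p - (u + v)) := by
  have hv0 : (v : ZMod p) ≠ 0 := natCast_ne_zero (by simp; omega)
  have hm : ((p - 1 - v : ℕ) : ZMod p) + 1 = -v := by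
    rw [← natCast_sub_eq_neg (show v ≤ p by omega), show p - v = p - 1 - v + 1 by omega]
    push_cast
    rfl
  have h1 : -(v : ZMod p) * ∑ s ∈ Ico 1 p, ((s : ZMod p)⁻¹) ^ u *
        ∑ k ∈ Ico 1 s, ((k : ZMod p)⁻¹) ^ v =
      ∑ i ∈ range (p - v), B i * ((p - v).choose i : ZMod p) *
        ∑ s ∈ Ico 1 p, (s : ZMod p) ^ (p - 1 - u + (p - v - i)) := by
    simp_rw [mul_sum (s := Ico 1 p)]
    rw [sum_comm]
    refine sum_congr rfl fun s hs => ?_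
    have h2 : ∑ k ∈ Ico 1 s, ((k : ZMod p)⁻¹) ^ v = ∑ k ∈ range s, (k : ZMod p) ^ (p - 1 - v) := by
      rw [mem_Ico] at hs
      rw [range_eq_Ico, sum_eq_sum_Ico_succ_bot hs.1, Nat.cast_zero, zero_pow (by omega), zero_add]
      exact sum_congr rfl fun k hk => inv_pow_eq_pow (by simp at hk ⊢; omega) (by omega)
    have h3 := hB (p - 1 - v) (by omega) s
    rw [hm, show p - 1 - v + 1 = p - v by omega] at h3
    rw [h2, mul_left_comm, h3, inv_pow_eq_pow hs (by omega), mul_sum]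
    exact sum_congr rfl fun i _ => by ring
  rw [sum_eq_single (s := range (p - v)) (p - (u + v))] at h1
  · rw [sum_pow_eq, if_pos (by
      rw [show p - 1 - u + (p - v - (p - (u + v))) = p - 1 by omega]),
      ← Nat.choose_symm (by omega), show p - v - (p - (u + v)) = u by omega,
      choose_sub_eq hv (by omega), hu.neg_one_pow] at h1
    have e := congrArg (Nat.cast : ℕ → ZMod p) (Nat.choose_mul_succ_eq (u + v - 1) u)
    rw [show u + v - 1 + 1 = u + v by omega, Nat.add_sub_cancel_left, Nat.cast_mul, Nat.cast_mul] at e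
    apply mul_left_cancel₀ hv0
    linear_combination -((u + v : ℕ) : ZMod p) * h1 + B (p - (u + v)) * e
  · intro i hi hne
    rw [mem_range] at hi
    rw [sum_pow_eq, if_neg, mul_zero]
    intro hd
    obtain ⟨c, hc⟩ := hd
    have hc2 : c < 2 := by
      by_contra! hc2
      have := Nat.mul_le_mul_left (p - 1) hc2
      omega
    interval_cases c <;> omega
  · intro hi
    simp at hi
    omega

end Double

lemma sum_choose_sub (W l : ℕ) :
    ∑ b ∈ range l, (((W + 1).choose (2 * b + 1) : ℤ) - (W + 1).choose (2 * b + 2)) =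
      1 - W.choose (2 * l) := by
  induction l with
  | zero => simp
  | succ l ih =>
    rw [sum_range_succ, ih, Nat.choose_succ_succ' W (2 * l), Nat.choose_succ_succ' W (2 * l + 1),
      show 2 * (l + 1) = 2 * l + 1 + 1 by ring]
    push_cast
    ring

/-- The sum of the truncated values of `({2}^(l+m+j), 3, {2}^(l-j-1))` modulo `p`. -/
lemma sum_zSum_replicate_three {p h : ℕ} [Fact p.Prime] (hp : p = 2 * h + 1) {B : ℕ → ZMod p}
    (hB : IsFaulhaber p B) {l m : ℕ} (hl : 4 * l + 2 * m + 2 < p) :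
    ((4 * l + 2 * m + 1 : ℕ) : ZMod p) * ∑ j ∈ range l, zSum (fun n => (n : ZMod p)⁻¹) p
        (List.replicate (l + m + j) 2 ++ 3 :: List.replicate (l - j - 1) 2) 1 =
      (-1) ^ m * 2 * (1 - ((4 * l + 2 * m).choose (2 * l) : ZMod p)) *
        B (p - (4 * l + 2 * m + 1)) := by
  have hW := congrArg (Int.cast : ℤ → ZMod p) (sum_choose_sub (4 * l + 2 * m) l)
  push_cast at hW
  rw [← sum_range_reflect] at hW
  rw [← hW, mul_sum, mul_sum, sum_mul]
  refine sum_congr rfl fun j hj => ?_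
  rw [mem_range] at hj
  obtain ⟨b, rfl⟩ : ∃ b, l = j + 1 + b := ⟨l - j - 1, by omega⟩
  obtain ⟨a, ha⟩ : ∃ a, a = j + 1 + b + m + j := ⟨_, rfl⟩
  rw [← ha, show j + 1 + b - j - 1 = b by omega, show j + 1 + b - 1 - j = b by omega]
  have h1 := zSum_replicate_three_replicate hp (a := a) (b := b) (by omega) (by omega)
  have h2 := sum_sum_inv_pow hB (u := 2 * a + 2) (v := 2 * b + 1) (by simp [parity_simps])
    (by omega) (by omega) (by omega)
  have h3 := sum_sum_inv_pow hB (u := 2 * b + 2) (v := 2 * a + 1) (by simp [parity_simps])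
    (by omega) (by omega) (by omega)
  have e1 : 2 * a + 2 + (2 * b + 1) = 4 * (j + 1 + b) + 2 * m + 1 := by omega
  have e2 : 2 * b + 2 + (2 * a + 1) = 4 * (j + 1 + b) + 2 * m + 1 := by omega
  have e3 : (4 * (j + 1 + b) + 2 * m + 1).choose (2 * a + 2) =
      (4 * (j + 1 + b) + 2 * m + 1).choose (2 * b + 1) := by
    rw [← e1]
    exact Nat.choose_symm_add
  rw [e1, e3] at h2
  rw [e2] at h3
  have hs : (-1 : ZMod p) ^ (a + b) = -(-1) ^ m := by
    rw [ha, show j + 1 + b + m + j + b = 2 * (j + b) + 1 + m by ring, pow_add, pow_succ, pow_mul]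
    simp
  have hm : ((-1 : ZMod p) ^ m) * (-1) ^ m = 1 := by
    rw [← mul_pow]
    simp
  rw [hs] at h1
  linear_combination (-(-1) ^ m * ((4 * (j + 1 + b) + 2 * m + 1 : ℕ) : ZMod p)) * h1
    - ((4 * (j + 1 + b) + 2 * m + 1 : ℕ) : ZMod p) * zSum (fun n => (n : ZMod p)⁻¹) p
      (List.replicate a 2 ++ 3 :: List.replicate b 2) 1 * hm
    + 2 * (-1) ^ m * h2 - 2 * (-1) ^ m * h3

section PadicInt

variable {p : ℕ} [Fact p.Prime]

lemma toZMod_eq_zero_iff {x : ℤ_[p]} : PadicInt.toZMod x = 0 ↔ (p : ℤ_[p]) ∣ x := by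
  rw [← RingHom.mem_ker, PadicInt.ker_toZMod, PadicInt.maximalIdeal_eq_span_p,
    Ideal.mem_span_singleton]

lemma toZMod_eq_iff {x y : ℤ_[p]} :
    PadicInt.toZMod x = PadicInt.toZMod y ↔ (p : ℤ_[p]) ∣ x - y := by
  rw [← toZMod_eq_zero_iff, map_sub, sub_eq_zero]

lemma isUnit_iff_toZMod_ne_zero {x : ℤ_[p]} : IsUnit x ↔ PadicInt.toZMod x ≠ 0 := by
  rw [Ne, ← RingHom.mem_ker, PadicInt.ker_toZMod, IsLocalRing.mem_maximalIdeal, mem_nonunits_iff,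
    not_not]

lemma isUnit_natCast {j : ℕ} (hj : j ∈ Ico 1 p) : IsUnit (j : ℤ_[p]) := by
  rw [isUnit_iff_toZMod_ne_zero, map_natCast]
  exact natCast_ne_zero hj

/-- The inverse of `n` in `ℤ_[p]`, for `n` prime to `p`. -/
noncomputable def padicInv (p : ℕ) [Fact p.Prime] (n : ℕ) : ℤ_[p] := Ring.inverse (n : ℤ_[p])

lemma natCast_mul_padicInv {j : ℕ} (hj : j ∈ Ico 1 p) : (j : ℤ_[p]) * padicInv p j = 1 :=
  Ring.mul_inverse_cancel _ (isUnit_natCast hj)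

lemma toZMod_padicInv {j : ℕ} (hj : j ∈ Ico 1 p) :
    PadicInt.toZMod (padicInv p j) = (j : ZMod p)⁻¹ := by
  have h := congrArg PadicInt.toZMod (natCast_mul_padicInv hj)
  rw [map_mul, map_natCast, map_one] at h
  exact (inv_eq_of_mul_eq_one_right h).symm

lemma coe_padicInv {j : ℕ} (hj : j ∈ Ico 1 p) : (padicInv p j : ℚ_[p]) = (j : ℚ_[p])⁻¹ := by
  have h := congrArg (PadicInt.Coe.ringHom (p := p)) (natCast_mul_padicInv hj)
  rw [map_mul, map_natCast, map_one] at h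
  exact (inv_eq_of_mul_eq_one_right h).symm

/-- The `i`-th Bernoulli number as a `p`-adic integer, for `i + 1 < p`. -/
noncomputable def padicBernoulli (p : ℕ) [Fact p.Prime] (i : ℕ) : ℤ_[p] :=
  open Classical in
  if h : ∃ b : ℤ_[p], (b : ℚ_[p]) = ((bernoulli i : ℚ) : ℚ_[p]) then h.choose else 0

lemma coe_padicBernoulli {i : ℕ} (hi : i + 1 < p) :
    (padicBernoulli p i : ℚ_[p]) = ((bernoulli i : ℚ) : ℚ_[p]) := by
  induction i using Nat.strong_induction_on with
  | _ i ih =>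
    suffices h : ∃ b : ℤ_[p], (b : ℚ_[p]) = ((bernoulli i : ℚ) : ℚ_[p]) by
      rw [padicBernoulli, dif_pos h]
      exact h.choose_spec
    have h1 := congrArg (Rat.cast : ℚ → ℚ_[p]) (sum_bernoulli (i + 1))
    have hu : i + 1 ∈ Ico 1 p := by simp; omega
    rw [sum_range_succ, Nat.choose_succ_self_right] at h1
    refine ⟨padicInv p (i + 1) * ((if i = 0 then 1 else 0) -
      ∑ k ∈ range i, ((i + 1).choose k : ℤ_[p]) * padicBernoulli p k), ?_⟩
    have h0 : ((i + 1 : ℕ) : ℚ_[p]) ≠ 0 := Nat.cast_ne_zero.2 i.succ_ne_zero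
    have h2 : ((∑ k ∈ range i, ((i + 1).choose k : ℤ_[p]) * padicBernoulli p k : ℤ_[p]) : ℚ_[p]) =
        ∑ k ∈ range i, ((i + 1).choose k : ℚ_[p]) * ((bernoulli k : ℚ) : ℚ_[p]) := by
      rw [PadicInt.coe_sum]
      refine sum_congr rfl fun k hk => ?_
      rw [mem_range] at hk
      rw [PadicInt.coe_mul, PadicInt.coe_natCast, ih k hk (by omega)]
    push_cast at h1
    rw [PadicInt.coe_mul, PadicInt.coe_sub, h2, coe_padicInv hu]
    rw [inv_mul_eq_iff_eq_mul₀ h0]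
    push_cast
    split_ifs at h1 ⊢ <;> first | omega | (push_cast at h1 ⊢; linear_combination -h1)

/-- Faulhaber's formula in `ℤ_[p]`. -/
lemma sum_range_pow_padicInt {m : ℕ} (hm : m + 1 < p) (n : ℕ) :
    ((m : ℤ_[p]) + 1) * ∑ k ∈ range n, (k : ℤ_[p]) ^ m =
      ∑ i ∈ range (m + 1), padicBernoulli p i * ((m + 1).choose i : ℤ_[p]) *
        (n : ℤ_[p]) ^ (m + 1 - i) := by
  have h1 := congrArg (Rat.cast : ℚ → ℚ_[p]) (sum_range_pow n m)
  apply PadicInt.ext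
  push_cast at h1
  rw [PadicInt.coe_mul, PadicInt.coe_sum, PadicInt.coe_sum]
  push_cast
  rw [h1, mul_sum]
  refine sum_congr rfl fun i hi => ?_
  rw [mem_range] at hi
  have h0 : (m : ℚ_[p]) + 1 ≠ 0 := Nat.cast_add_one_ne_zero m
  rw [coe_padicBernoulli (by omega)]
  field_simp

lemma isFaulhaber_padicBernoulli :
    IsFaulhaber p fun i => PadicInt.toZMod (padicBernoulli p i) := by
  intro m hm n
  have h := congrArg PadicInt.toZMod (sum_range_pow_padicInt hm n)
  simpa using h

/-- `∑ k^m ≡ p B_m (mod p²)` for `0 < m < p - 1`. -/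
lemma sum_pow_modEq {m : ℕ} (hm0 : 0 < m) (hm : m + 1 < p) :
    (p : ℤ_[p]) ^ 2 ∣ ∑ k ∈ Ico 1 p, (k : ℤ_[p]) ^ m - p * padicBernoulli p m := by
  have h := sum_range_pow_padicInt hm p
  have hu : IsUnit ((m : ℤ_[p]) + 1) := by
    exact_mod_cast isUnit_natCast (show m + 1 ∈ Ico 1 p by simp; omega)
  rw [range_eq_Ico, sum_eq_sum_Ico_succ_bot (by omega), Nat.cast_zero, zero_pow (by omega),
    zero_add, zero_add, sum_range_succ, Nat.choose_succ_self_right, Nat.add_sub_cancel_left,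
    pow_one] at h
  rw [← hu.dvd_mul_left, mul_sub, h, Nat.cast_add, Nat.cast_one,
    show padicBernoulli p m * ((m : ℤ_[p]) + 1) * p = (m + 1) * (p * padicBernoulli p m) by ring,
    add_sub_cancel_right]
  refine dvd_sum fun i hi => ?_
  rw [mem_range] at hi
  exact (pow_dvd_pow _ (by omega)).mul_left _

end PadicInt

lemma elemSum_eq_sum_powersetCard {R : Type*} [CommRing R] (c : ℕ → R) (a s t : ℕ) :
    elemSum c a s t = ∑ u ∈ powersetCard a (Ico s t), ∏ i ∈ u, c i := by
  rw [elemSum, prod_one_add, finsetSum_coeff, powersetCard_eq_filter, sum_filter]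
  refine sum_congr rfl fun u _ => ?_
  rw [prod_mul_distrib, prod_const, ← map_prod, coeff_C_mul_X_pow]
  simp only [eq_comm]

/-- Newton's identity for `elemSum`. -/
lemma mul_elemSum_eq_sum {R : Type*} [CommRing R] (c : ℕ → R) (a s t : ℕ) :
    (a : R) * elemSum c a s t = (-1) ^ (a + 1) * ∑ x ∈ antidiagonal a with x.1 < a,
      (-1) ^ x.1 * elemSum c x.1 s t * ∑ j ∈ Ico s t, c j ^ x.2 := by
  have hm : (univ : Finset (Ico s t)).val.map (fun j : Ico s t => c j) = (Ico s t).val.map c := by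
    rw [univ_eq_attach, attach_val]
    exact Multiset.attach_map_val' _ c
  have he : ∀ a, MvPolynomial.aeval (fun j : Ico s t => c j) (MvPolynomial.esymm (Ico s t) R a) =
      elemSum c a s t := fun a => by
    rw [MvPolynomial.aeval_esymm_eq_multiset_esymm, hm, esymm_map_val, elemSum_eq_sum_powersetCard]
  have h := congrArg (MvPolynomial.aeval fun j : Ico s t => c j)
    (MvPolynomial.mul_esymm_eq_sum (Ico s t) R a)
  simp only [map_mul, map_natCast, map_pow, map_neg, map_one, map_sum, he,
    MvPolynomial.psum, MvPolynomial.aeval_X] at h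
  rw [h]
  congr 1
  refine sum_congr rfl fun x _ => ?_
  rw [univ_eq_attach, sum_attach (Ico s t) fun j => c j ^ x.2]

/-- Newton's identity modulo `π ^ 2` when the lower symmetric sums are divisible by `π`. -/
lemma mul_elemSum_modEq {R : Type*} [CommRing R] {π : R} {c : ℕ → R} {a s t : ℕ} (ha : 0 < a)
    (he : ∀ i, 0 < i → i < a → π ∣ elemSum c i s t)
    (hs : ∀ i, 0 < i → i < a → π ∣ ∑ j ∈ Ico s t, c j ^ i) :
    π ^ 2 ∣ (a : R) * elemSum c a s t - (-1) ^ (a + 1) * ∑ j ∈ Ico s t, c j ^ a := by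
  have h0 : (0, a) ∈ {x ∈ antidiagonal a | x.1 < a} := by simp [ha]
  rw [mul_elemSum_eq_sum, ← add_sum_erase _ _ h0, pow_zero, elemSum_zero, one_mul, one_mul, mul_add,
    add_sub_cancel_left]
  refine (dvd_sum fun x hx => ?_).mul_left _
  obtain ⟨i, j⟩ := x
  simp only [mem_erase, mem_filter, HasAntidiagonal.mem_antidiagonal, ne_eq, Prod.mk.injEq] at hx
  rw [sq]
  exact mul_dvd_mul ((he i (by omega) (by omega)).mul_left _) (hs j (by omega) (by omega))

section Double

/-- Splitting `1, …, p - 1` into even and odd numbers when `p = 2h + 1`. -/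
lemma sum_Ico_even_odd {M : Type*} [AddCommMonoid M] {p h : ℕ} (hp : p = 2 * h + 1) (F : ℕ → M) :
    ∑ n ∈ Ico 1 p, F n = ∑ k ∈ Ico 1 (h + 1), (F (2 * k) + F (p - 2 * k)) := by
  have h1 : ∑ n ∈ Ico 1 p, F n = ∑ k ∈ Ico 1 (h + 1), (F (2 * k) + F (2 * k - 1)) := by
    subst hp
    induction h with
    | zero => simp
    | succ h ih =>
      rw [show 2 * (h + 1) + 1 = 2 * h + 1 + 1 + 1 by ring, sum_Ico_succ_top (by omega),
        sum_Ico_succ_top (by omega), ih, sum_Ico_succ_top (b := h + 1) (by omega), add_assoc,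
        add_comm (F (2 * h + 1))]
      rfl
  rw [h1, sum_add_distrib, sum_add_distrib]
  congr 1
  have h2 := sum_Ico_reflect (fun k => F (2 * k - 1)) 1 (show h + 1 ≤ h + 1 + 1 by omega)
  rw [show h + 1 + 1 - (h + 1) = 1 by omega, Nat.add_sub_cancel] at h2
  rw [← h2]
  refine sum_congr rfl fun k hk => ?_
  rw [mem_Ico] at hk
  congr 1
  omega

lemma two_mul_one_sub_mul_sum {R : Type*} [CommRing R] {p h : ℕ} (hp : p = 2 * h + 1)
    {F F' : ℕ → R} {c : R} (h1 : ∀ k ∈ Ico 1 (h + 1), F (2 * k) = c * F k)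
    (h2 : ∀ k ∈ Ico 1 (h + 1), 2 * F' (2 * k) = c * F' k)
    (h3 : ∀ j ∈ Ico 1 p, (p : R) ^ 2 ∣ F (p - j) - F j + p * F' j) :
    (p : R) ^ 2 ∣ 2 * (1 - c) * ∑ j ∈ Ico 1 p, F j - c * p * ∑ k ∈ Ico 1 (h + 1), F' k := by
  have e1 := sum_Ico_fold hp F
  have e2 := sum_Ico_even_odd hp F
  have d1 : (p : R) ^ 2 ∣ ∑ k ∈ Ico 1 (h + 1), (F (p - k) - F k + p * F' k) :=
    dvd_sum fun k hk => h3 k (by simp at hk ⊢; omega)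
  have d2 : (p : R) ^ 2 ∣ ∑ k ∈ Ico 1 (h + 1), (F (p - 2 * k) - F (2 * k) + p * F' (2 * k)) :=
    dvd_sum fun k hk => h3 (2 * k) (by simp at hk ⊢; omega)
  have e3 : 2 * ∑ k ∈ Ico 1 (h + 1), F' (2 * k) = c * ∑ k ∈ Ico 1 (h + 1), F' k := by
    rw [mul_sum, mul_sum]
    exact sum_congr rfl h2
  have e4 : ∑ k ∈ Ico 1 (h + 1), F (2 * k) = c * ∑ k ∈ Ico 1 (h + 1), F k := by
    rw [mul_sum]
    exact sum_congr rfl h1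
  rw [sum_add_distrib] at e1 e2
  rw [sum_add_distrib, sum_sub_distrib, ← mul_sum] at d1 d2
  obtain ⟨x, hx⟩ := d1
  obtain ⟨y, hy⟩ := d2
  refine ⟨2 * y - 2 * c * x, ?_⟩
  linear_combination 2 * e2 - 2 * c * e1 - 2 * c * hx + 2 * hy + 4 * e4 - p * e3

end Double

section PowerSum

variable {p : ℕ} [Fact p.Prime]

lemma padicInv_mul (a b : ℕ) : padicInv p (a * b) = padicInv p a * padicInv p b := by
  rw [padicInv, Nat.cast_mul, Ring.mul_inverse_rev, mul_comm]
  rfl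

lemma padicInv_reflect {j : ℕ} (hj : j ∈ Ico 1 p) :
    (p : ℤ_[p]) ^ 2 ∣ padicInv p (p - j) + (padicInv p j + p * padicInv p j ^ 2) := by
  have hj' : p - j ∈ Ico 1 p := by simp at hj ⊢; omega
  have h1 := natCast_mul_padicInv hj
  have h2 := natCast_mul_padicInv hj'
  rw [← (isUnit_natCast hj').dvd_mul_left, mul_add, h2, Nat.cast_sub (mem_Ico.1 hj).2.le]
  refine ⟨padicInv p j ^ 2, ?_⟩
  linear_combination (-1 - p * padicInv p j) * h1

lemma padicInv_reflect_pow {N j : ℕ} (hj : j ∈ Ico 1 p) :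
    (p : ℤ_[p]) ^ 2 ∣ padicInv p (p - j) ^ (2 * (N + 1)) - padicInv p j ^ (2 * (N + 1)) +
      p * (-(2 * (N + 1)) * padicInv p j ^ (2 * (N + 1) + 1)) := by
  have h1 := (padicInv_reflect hj).trans (b := _) (c := padicInv p (p - j) ^ (2 * (N + 1)) -
    (-(padicInv p j + p * padicInv p j ^ 2)) ^ (2 * (N + 1))) (by
      have := sub_dvd_pow_sub_pow (padicInv p (p - j)) (-(padicInv p j + p * padicInv p j ^ 2))
        (2 * (N + 1))
      rwa [sub_neg_eq_add] at this)
  rw [(even_two_mul _).neg_pow] at h1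
  obtain ⟨k, hk⟩ := Polynomial.powAddExpansion (padicInv p j) (p * padicInv p j ^ 2) (2 * (N + 1))
  obtain ⟨z, hz⟩ := h1
  rw [hk, show 2 * (N + 1) - 1 = 2 * N + 1 by omega] at hz
  push_cast at hz
  refine ⟨z + k * (padicInv p j ^ 2) ^ 2, ?_⟩
  linear_combination hz

lemma natCast_reflect_pow {m j : ℕ} (hm : Even m) (hj : j ∈ Ico 1 p) :
    (p : ℤ_[p]) ^ 2 ∣ ((p - j : ℕ) : ℤ_[p]) ^ m - (j : ℤ_[p]) ^ m +
      p * (m * (j : ℤ_[p]) ^ (m - 1)) := by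
  obtain ⟨k, hk⟩ := Polynomial.powAddExpansion (j : ℤ_[p]) (-p) m
  refine ⟨k, ?_⟩
  rw [Nat.cast_sub (mem_Ico.1 hj).2.le, ← neg_sub (j : ℤ_[p]), hm.neg_pow, sub_eq_add_neg (j : ℤ_[p]), hk]
  ring

lemma dvd_sum_padicInv_pow {e : ℕ} (he : 0 < e) (hep : e < p - 1) :
    (p : ℤ_[p]) ∣ ∑ j ∈ Ico 1 p, padicInv p j ^ e := by
  rw [← toZMod_eq_zero_iff, map_sum]
  rw [sum_congr rfl fun j hj => by
    rw [map_pow, toZMod_padicInv hj, inv_pow_eq_pow hj hep.le], sum_pow_eq, if_neg]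
  exact Nat.not_dvd_of_pos_of_lt (by omega) (by omega)

/-- Comparison of `∑ 1/n^(2N)` and `∑ n^(p-1-2N)` modulo `p²`. -/
lemma sum_padicInv_pow_modEq {h N : ℕ} (hp : p = 2 * h + 1) (hN : 0 < N) (hNp : 2 * N + 2 < p)
    (h4 : 4 ^ N < p) :
    (p : ℤ_[p]) ^ 2 ∣ ((2 * N + 1 : ℕ) : ℤ_[p]) * ∑ j ∈ Ico 1 p, padicInv p j ^ (2 * N) -
      2 * N * ∑ j ∈ Ico 1 p, (j : ℤ_[p]) ^ (p - 1 - 2 * N) := by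
  have h2 : 2 ∈ Ico 1 p := by simp; omega
  have hi2 := natCast_mul_padicInv h2
  push_cast at hi2
  have hm : Even (p - 1 - 2 * N) := by
    rw [show p - 1 - 2 * N = 2 * (h - N) by omega]
    exact even_two_mul _
  have d1 := two_mul_one_sub_mul_sum hp (F := fun k => (k : ℤ_[p]) ^ (p - 1 - 2 * N))
    (F' := fun k => ((p - 1 - 2 * N : ℕ) : ℤ_[p]) * (k : ℤ_[p]) ^ (p - 1 - 2 * N - 1))
    (c := 2 ^ (p - 1 - 2 * N))
    (fun k _ => by push_cast; rw [mul_pow])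
    (fun k _ => by
      obtain ⟨m, hm⟩ : ∃ m, p - 1 - 2 * N = m + 1 := ⟨p - 1 - 2 * N - 1, by omega⟩
      rw [hm, Nat.add_sub_cancel]
      push_cast
      ring)
    (fun j hj => natCast_reflect_pow hm hj)
  have d2 := two_mul_one_sub_mul_sum hp (F := fun k => padicInv p k ^ (2 * N))
    (F' := fun k => -(2 * N) * padicInv p k ^ (2 * N + 1))
    (c := padicInv p 2 ^ (2 * N))
    (fun k _ => by rw [padicInv_mul, mul_pow])
    (fun k _ => by
      rw [padicInv_mul]
      linear_combination (-(2 * N) * padicInv p 2 ^ (2 * N) * padicInv p k ^ (2 * N + 1)) * hi2)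
    (fun j hj => by
      obtain ⟨N, rfl⟩ : ∃ M, N = M + 1 := ⟨N - 1, by omega⟩
      simpa using padicInv_reflect_pow (N := N) hj)
  have hA : (p : ℤ_[p]) ∣ ∑ j ∈ Ico 1 p, (j : ℤ_[p]) ^ (p - 1 - 2 * N) := by
    rw [← toZMod_eq_zero_iff, map_sum]
    simp only [map_pow, map_natCast]
    rw [sum_pow_eq, if_neg]
    exact Nat.not_dvd_of_pos_of_lt (by omega) (by omega)
  have hc : (p : ℤ_[p]) ∣ 2 ^ (p - 1 - 2 * N) - padicInv p 2 ^ (2 * N) := by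
    rw [← toZMod_eq_iff, map_pow, map_pow, toZMod_padicInv h2, inv_pow_eq_pow h2 (by omega)]
    exact congrArg (· ^ _) (map_natCast PadicInt.toZMod 2)
  have hM : (p : ℤ_[p]) ∣ ∑ k ∈ Ico 1 (h + 1), (k : ℤ_[p]) ^ (p - 1 - 2 * N - 1) -
      ∑ k ∈ Ico 1 (h + 1), padicInv p k ^ (2 * N + 1) := by
    rw [← toZMod_eq_iff, map_sum, map_sum]
    refine sum_congr rfl fun k hk => ?_
    have hk' : k ∈ Ico 1 p := by simp at hk ⊢; omega
    rw [map_pow, map_pow, toZMod_padicInv hk', inv_pow_eq_pow hk' (by omega), map_natCast]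
    congr 1
  have hu : IsUnit (2 * (1 - padicInv p 2 ^ (2 * N))) := by
    have hu2 : IsUnit (2 : ℤ_[p]) := by exact_mod_cast isUnit_natCast h2
    refine hu2.mul ?_
    have hpow : (4 : ℤ_[p]) ^ N * padicInv p 2 ^ (2 * N) = 1 := by
      rw [show (4 : ℤ_[p]) = 2 ^ 2 by norm_num, ← pow_mul, ← mul_pow, hi2, one_pow]
    have hu4 : IsUnit ((4 : ℤ_[p]) ^ N * (1 - padicInv p 2 ^ (2 * N))) := by
      rw [mul_sub, hpow, mul_one]
      have := isUnit_natCast (p := p) (j := 4 ^ N - 1) (by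
        have : 4 ^ 1 ≤ 4 ^ N := Nat.pow_le_pow_right (by norm_num) hN
        simp
        omega)
      rw [Nat.cast_sub (Nat.pow_pos (by norm_num))] at this
      simpa using this
    exact isUnit_of_mul_isUnit_right hu4
  rw [← mul_sum] at d1 d2
  have hr : ((p - 1 - 2 * N : ℕ) : ℤ_[p]) = p - (2 * N + 1) := by
    rw [Nat.sub_sub, Nat.cast_sub (by omega)]
    push_cast
    ring
  rw [hr] at d1
  rw [← hu.dvd_mul_left]
  generalize ∑ j ∈ Ico 1 p, (j : ℤ_[p]) ^ (p - 1 - 2 * N) = A at *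
  generalize ∑ j ∈ Ico 1 p, padicInv p j ^ (2 * N) = H at *
  generalize ∑ k ∈ Ico 1 (h + 1), (k : ℤ_[p]) ^ (p - 1 - 2 * N - 1) = M1 at *
  generalize ∑ k ∈ Ico 1 (h + 1), padicInv p k ^ (2 * N + 1) = M2 at *
  generalize (2 : ℤ_[p]) ^ (p - 1 - 2 * N) = c1 at *
  generalize padicInv p 2 ^ (2 * N) = c2 at *
  obtain ⟨x, hx⟩ := d1
  obtain ⟨y, hy⟩ := d2
  obtain ⟨A', rfl⟩ := hA
  obtain ⟨t, ht⟩ := hM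
  obtain ⟨z, hz⟩ := hc
  obtain rfl := sub_eq_iff_eq_add.1 hz
  obtain rfl := sub_eq_iff_eq_add.1 ht
  refine ⟨(2 * N + 1) * y - 2 * N * x - 4 * N * z * A' -
    2 * N * ((p * z + c2) * (p * t + M2) - (2 * N + 1) * (z * (p * t + M2) + c2 * t)), ?_⟩
  push_cast
  linear_combination (2 * N + 1) * hy - 2 * N * hx

end PowerSum

section Main

variable {p h : ℕ} [Fact p.Prime]

lemma dvd_elemSum_padicInv (hp : p = 2 * h + 1) {a : ℕ} (ha : 0 < a) (hah : a < h) :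
    (p : ℤ_[p]) ∣ elemSum (fun n => padicInv p n ^ 2) a 1 p := by
  rw [← toZMod_eq_zero_iff, map_elemSum]
  have h1 : elemSum (fun n => PadicInt.toZMod (padicInv p n ^ 2)) a 1 p =
      elemSum (fun n => -(-((n : ZMod p) ^ 2)⁻¹)) a 1 p := by
    rw [elemSum, elemSum]
    congr 1
    refine prod_congr rfl fun j hj => ?_
    rw [map_pow, toZMod_padicInv hj, inv_pow, neg_neg]
  have h2 : ∏ n ∈ Ico 1 p, (1 + C (-((n : ZMod p) ^ 2)⁻¹) * X) = (1 - X ^ h) ^ 2 := by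
    rw [← prod_one_sub_half hp, ← prod_Ico_consecutive _ (show 1 ≤ h + 1 by omega)
      (show h + 1 ≤ p by omega), sq]
    congr 1
    have h3 := prod_Ico_reflect (fun n : ℕ => 1 + C (-((n : ZMod p) ^ 2)⁻¹) * X) 1
      (show h + 1 ≤ p + 1 by omega)
    rw [show p + 1 - (h + 1) = h + 1 by omega, Nat.add_sub_cancel] at h3
    rw [← h3]
    exact prod_congr rfl fun j hj => by
      rw [natCast_reflect (by simp at hj ⊢; omega), neg_sq]
  rw [h1, elemSum_neg, elemSum, h2, show (1 - X ^ h : (ZMod p)[X]) ^ 2 =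
    1 - C 2 * X ^ h + X ^ (2 * h) by rw [map_ofNat]; ring]
  rw [coeff_add, coeff_sub, coeff_C_mul, coeff_X_pow, coeff_X_pow, coeff_one, if_neg (by omega),
    if_neg (by omega), if_neg (by omega)]
  simp

/-- `Z_p({2}^N)` modulo `p²`. -/
lemma elemSum_padicInv_modEq (hp : p = 2 * h + 1) {N : ℕ} (hN : 0 < N) (hNp : 2 * N + 2 < p)
    (h4 : 4 ^ N < p) :
    (p : ℤ_[p]) ^ 2 ∣ ((2 * N + 1 : ℕ) : ℤ_[p]) * elemSum (fun n => padicInv p n ^ 2) N 1 p -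
      (-1) ^ (N + 1) * 2 * (p * padicBernoulli p (p - (2 * N + 1))) := by
  have h1 := sum_padicInv_pow_modEq hp hN hNp h4
  have h2 := mul_elemSum_modEq (π := (p : ℤ_[p])) (c := fun n => padicInv p n ^ 2) (s := 1) (t := p)
    hN (fun i hi hiN => dvd_elemSum_padicInv hp hi (by omega))
    (fun i hi hiN => by
      simp only [← pow_mul]
      exact dvd_sum_padicInv_pow (by omega) (by omega))
  simp only [← pow_mul] at h2
  have h3 := sum_pow_modEq (p := p) (m := p - (2 * N + 1)) (by omega) (by omega)
  rw [show p - 1 - 2 * N = p - (2 * N + 1) by omega] at h1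
  have hu : IsUnit (N : ℤ_[p]) := isUnit_natCast (by simp; omega)
  rw [← hu.dvd_mul_left]
  obtain ⟨x, hx⟩ := h1
  obtain ⟨y, hy⟩ := h2
  obtain ⟨z, hz⟩ := h3
  refine ⟨((2 * N + 1 : ℕ) : ℤ_[p]) * y + (-1) ^ (N + 1) * (x + 2 * N * z), ?_⟩
  linear_combination ((2 * N + 1 : ℕ) : ℤ_[p]) * hy + (-1) ^ (N + 1) * (hx + 2 * N * hz)

lemma zSum_congr {R : Type*} [CommRing R] {f g : ℕ → R} {N : ℕ} (hfg : ∀ n ∈ Ico 1 N, f n = g n)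
    (ks : List ℕ) {s : ℕ} (hs : 1 ≤ s) : zSum f N ks s = zSum g N ks s := by
  induction ks generalizing s with
  | nil => rfl
  | cons k ks ih =>
    rw [zSum, zSum]
    exact sum_congr rfl fun n hn => by
      rw [hfg n (by simp at hn ⊢; omega), ih (by omega)]

/-- The congruence in `ℤ_[p]`, multiplied by `4l + 2m + 1`. -/
lemma main_modEq (hp : p = 2 * h + 1) {l m : ℕ} (hlm : 0 < 2 * l + m)
    (hlp : 4 * l + 2 * m + 2 < p) (h4 : 4 ^ (2 * l + m) < p) :
    (p : ℤ_[p]) ^ 2 ∣ ((4 * l + 2 * m + 1 : ℕ) : ℤ_[p]) *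
        (zSum (padicInv p) p (List.replicate (2 * l + m) 2) 1 + 2 * p * ∑ j ∈ range l,
          zSum (padicInv p) p (List.replicate (l + m + j) 2 ++ 3 :: List.replicate (l - j - 1) 2) 1) -
      (-1) ^ m * 2 * (1 - 2 * ((4 * l + 2 * m).choose (2 * l) : ℤ_[p])) *
        padicBernoulli p (p - (4 * l + 2 * m + 1)) * p := by
  have h1 := elemSum_padicInv_modEq hp hlm (by omega) h4
  have h2 := sum_zSum_replicate_three hp (isFaulhaber_padicBernoulli (p := p)) hlp
  have h3 : (p : ℤ_[p]) ∣ ((4 * l + 2 * m + 1 : ℕ) : ℤ_[p]) * ∑ j ∈ range l,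
      zSum (padicInv p) p (List.replicate (l + m + j) 2 ++ 3 :: List.replicate (l - j - 1) 2) 1 -
      (-1) ^ m * 2 * (1 - ((4 * l + 2 * m).choose (2 * l) : ℤ_[p])) *
        padicBernoulli p (p - (4 * l + 2 * m + 1)) := by
    rw [← toZMod_eq_iff]
    simp only [map_mul, map_sum, map_sub, map_natCast, map_pow, map_neg, map_one, map_ofNat,
      map_zSum]
    rw [← h2]
    congr 1
    exact sum_congr rfl fun j _ => zSum_congr (fun n hn => toZMod_padicInv hn) _ le_rfl
  rw [← replicate_eq_elemSum, show 2 * (2 * l + m) + 1 = 4 * l + 2 * m + 1 by ring,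
    show 2 * l + m + 1 = 2 * l + (m + 1) by ring, pow_add, (even_two_mul l).neg_one_pow, one_mul,
    pow_succ] at h1
  obtain ⟨x, hx⟩ := h1
  obtain ⟨y, hy⟩ := h3
  refine ⟨x + 2 * y, ?_⟩
  linear_combination hx + 2 * p * hy

lemma coe_zSum_padicInv (ks : List ℕ) {s : ℕ} (hs : 1 ≤ s) :
    ((zSum (padicInv p) p ks s : ℤ_[p]) : ℚ_[p]) = ((ZAux (p - 1) ks s : ℚ) : ℚ_[p]) := by
  induction ks generalizing s with
  | nil => simp [zSum, ZAux]
  | cons k ks ih =>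
    have hp := (Fact.out : p.Prime).pos
    rw [zSum, ZAux, PadicInt.coe_sum]
    push_cast
    rw [show Icc s (p - 1) = Ico s p by ext; simp; omega]
    exact sum_congr rfl fun n hn => by
      rw [ih (by omega), coe_padicInv (by simp at hn ⊢; omega), inv_pow]

end Main

lemma congrMod_of_dvd {p : ℕ} [Fact p.Prime] {e : ℕ} {q r : ℚ} {x : ℤ_[p]}
    (hx : (x : ℚ_[p]) = ((q - r : ℚ) : ℚ_[p])) (h : (p : ℤ_[p]) ^ e ∣ x) : congrMod p e q r := by
  rw [← Ideal.mem_span_singleton, ← PadicInt.norm_le_pow_iff_mem_span_pow, PadicInt.norm_def, hx,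
    Padic.eq_padicNorm] at h
  rw [congrMod]
  rw [← Rat.cast_le (K := ℝ)]
  push_cast
  exact h

end zSum

/-- Murahara–Onozuka–Seki, Lemma 5: the value of `ζ_{𝒜₂}(({2}^{l+m}) ш ({2}^l))`, written out via
the shuffle relation. -/
theorem stmt11 (l m : ℕ) (h : (l, m) ≠ (0, 0)) :
    ∀ᶠ p in Filter.cofinite, p.Prime →
      congrMod p 2
        (Z p (List.replicate (2 * l + m) 2) +
          2 * p * ∑ j ∈ Finset.range l,
            Z p (List.replicate (l + m + j) 2 ++ 3 :: List.replicate (l - j - 1) 2))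
        ((-1 : ℚ) ^ m * 2 * (1 - 2 * ((4 * l + 2 * m).choose (2 * l) : ℚ)) *
          (bernoulli (p - (4 * l + 2 * m + 1)) / (4 * l + 2 * m + 1)) * p) := by
  have hlm : 0 < 2 * l + m := by
    by_contra! h0
    exact h (by rw [Prod.mk.injEq]; omega)
  rw [Nat.cofinite_eq_atTop]
  filter_upwards [Filter.eventually_gt_atTop (4 * l + 2 * m + 2),
    Filter.eventually_gt_atTop (4 ^ (2 * l + m))] with p hp1 hp2 hprime
  have : Fact p.Prime := ⟨hprime⟩
  obtain ⟨k, hk⟩ := hprime.odd_of_ne_two (by omega)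
  have hW : 4 * l + 2 * m + 1 ∈ Finset.Ico 1 p := by simp; omega
  have hinv := zSum.natCast_mul_padicInv hW
  have hmain := (zSum.main_modEq hk hlm hp1 hp2).mul_left
    (zSum.padicInv p (4 * l + 2 * m + 1))
  refine zSum.congrMod_of_dvd ?_ hmain
  rw [mul_sub, ← mul_assoc, mul_comm (zSum.padicInv p _) (Nat.cast _), hinv, one_mul, mul_comm]
  rw [PadicInt.coe_sub, PadicInt.coe_add, PadicInt.coe_mul, PadicInt.coe_mul, PadicInt.coe_sum]
  simp only [PadicInt.coe_mul]
  rw [zSum.coe_padicInv hW, zSum.coe_padicBernoulli (by omega), zSum.coe_zSum_padicInv _ le_rfl]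
  simp only [zSum.coe_zSum_padicInv _ le_rfl, Z]
  push_cast
  rw [show ((2 : ℤ_[p]) : ℚ_[p]) = 2 from map_ofNat PadicInt.Coe.ringHom 2]
  ring
end

section
/- For non-negative integers l and m with (l,m) ≠ (0,0), for all but finitely many primes p the following congruence of rational numbers holds modulo p²: Z_p(({2}^{l+m}) ш ({2}^l)) ≡ Z_p({2}^{2l+m}) + 2p · ∑_{j=0}^{l−1} Z_p({2}^{l+m+j}, 3, {2}^{l−j−1}) (mod p²), where Z_p is extended ℚ-linearly from indices to the ℚ-vector space ℜ spanned by indices. -/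
/-- The multiset of all interleavings (shuffles) of two lists, with multiplicity. -/
def shuffles {α : Type*} : List α → List α → Multiset (List α)
  | [], ys => {ys}
  | x :: xs, [] => {x :: xs}
  | x :: xs, y :: ys =>
      (shuffles xs (y :: ys)).map (x :: ·) + (shuffles (x :: xs) ys).map (y :: ·)
termination_by xs ys => xs.length + ys.length

/-- The product `⧢` of two indices, as an element of the ℚ-vector space `ℜ = (List ℕ →₀ ℚ)`
spanned by all indices: the formal sum of all interleavings of the two index sequences. -/
noncomputable def shT (k l : List ℕ) : List ℕ →₀ ℚ :=
  ((shuffles k l).map fun w => Finsupp.single w (1 : ℚ)).sum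

/-- The word `x^{k_r-1} y x^{k_{r-1}-1} y ⋯ x^{k₁-1} y` over `{x, y}` (`false` = `x`,
`true` = `y`) associated to the index `(k₁, …, k_r)`. -/
def toWord (ks : List ℕ) : List Bool :=
  (ks.reverse.map fun k => List.replicate (k - 1) false ++ [true]).flatten

def fromWordAux : List Bool → ℕ → List ℕ
  | [], _ => []
  | false :: w, c => fromWordAux w (c + 1)
  | true :: w, c => (c + 1) :: fromWordAux w 0

/-- The index associated to a word over `{x, y}` ending in `y`
(inverse of `toWord` on such words). -/
def fromWord (w : List Bool) : List ℕ := (fromWordAux w 0).reverse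

/-- The shuffle product `ш` of two indices, as an element of `ℜ = (List ℕ →₀ ℚ)`: the words of
the two indices are shuffled and each resulting word is converted back to an index. -/
noncomputable def shW (k l : List ℕ) : List ℕ →₀ ℚ :=
  ((shuffles (toWord k) (toWord l)).map fun w => Finsupp.single (fromWord w) (1 : ℚ)).sum

/-- The index `{1,3}^l = (1,3,1,3,…,1,3)`. -/
def rep13 (l : ℕ) : List ℕ := (List.replicate l ([1, 3] : List ℕ)).flatten


/-- `Z_p` extended ℚ-linearly to the ℚ-vector space `ℜ = (List ℕ →₀ ℚ)` spanned by indices. -/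
def ZR (p : ℕ) (v : List ℕ →₀ ℚ) : ℚ := v.sum fun ks q => q * Z p ks

section ShuffleSeries

open Finset PowerSeries

/-- The kernels `1` and `t / (1 - t)` of the differential operator `t d/dt` on polylogarithms. -/
noncomputable def polylogKernel : Bool → ℚ⟦X⟧
  | false => 1
  | true => X * PowerSeries.mk 1

/-- The multiple polylogarithm attached to a word over `{x, y}`, as a formal power series. -/
noncomputable def polylog : List Bool → ℚ⟦X⟧
  | [] => 1
  | b :: w => PowerSeries.mk fun n => coeff n (polylogKernel b * polylog w) / n

/-- The word is empty or ends in `y`. -/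
def EndsInY : List Bool → Prop
  | [] => True
  | [b] => b = true
  | _ :: b :: w => EndsInY (b :: w)

theorem EndsInY.tail {b : Bool} {w : List Bool} (h : EndsInY (b :: w)) : EndsInY w := by
  cases w with
  | nil => trivial
  | cons c w => exact h

theorem coeff_zero_polylog_cons (b : Bool) (w : List Bool) :
    coeff 0 (polylog (b :: w)) = 0 := by
  simp [polylog]

theorem coeff_zero_kernel_mul_polylog {b : Bool} {w : List Bool} (h : EndsInY (b :: w)) :
    coeff 0 (polylogKernel b * polylog w) = 0 := by
  cases b with
  | true => simp [polylogKernel, mul_assoc]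
  | false =>
    cases w with
    | nil => simp [EndsInY] at h
    | cons c w => simpa [polylogKernel] using coeff_zero_polylog_cons c w

theorem X_mul_derivative_polylog {b : Bool} {w : List Bool} (h : EndsInY (b :: w)) :
    X * d⁄dX ℚ (polylog (b :: w)) = polylogKernel b * polylog w := by
  ext n
  cases n with
  | zero => simpa using (coeff_zero_kernel_mul_polylog h).symm
  | succ n =>
    rw [coeff_succ_X_mul, coeff_derivative, polylog, coeff_mk]
    push_cast
    field_simp

theorem eq_of_X_mul_derivative_eq {f g : ℚ⟦X⟧} (h : X * d⁄dX ℚ f = X * d⁄dX ℚ g)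
    (h0 : coeff 0 f = coeff 0 g) : f = g := by
  apply derivative.ext
  · exact mul_left_cancel₀ X_ne_zero h
  · simpa using h0

theorem shuffles_nil_right {α : Type*} (u : List α) : shuffles u [] = {u} := by
  cases u <;> simp [shuffles]

theorem X_mul_derivative_polylog_sum (b : Bool) (s : Multiset (List Bool))
    (h : ∀ w ∈ s, EndsInY (b :: w)) :
    X * d⁄dX ℚ (((s.map (b :: ·)).map polylog).sum) =
      polylogKernel b * (s.map polylog).sum := by
  induction s using Multiset.induction with
  | empty => simp
  | cons w s ih =>
    have hw := X_mul_derivative_polylog (h w (by simp))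
    have hs := ih fun v hv => h v (by simp [hv])
    simp only [Multiset.map_cons, Multiset.sum_cons, map_add, mul_add, hw, hs]

theorem coeff_zero_polylog_sum (b : Bool) (s : Multiset (List Bool)) :
    coeff 0 (((s.map (b :: ·)).map polylog).sum) = 0 := by
  induction s using Multiset.induction with
  | empty => simp
  | cons w s ih =>
    simp only [Multiset.map_cons, Multiset.sum_cons, map_add, ih, coeff_zero_polylog_cons,
      add_zero]

theorem endsInY_cons {b : Bool} {w : List Bool} (hw : EndsInY w) (hne : w ≠ []) :
    EndsInY (b :: w) := by
  cases w with
  | nil => contradiction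
  | cons c w => exact hw

theorem endsInY_and_ne_nil_of_mem_shuffles (u v : List Bool) (hu : EndsInY u) (hv : EndsInY v) :
    ∀ w ∈ shuffles u v, EndsInY w ∧ (u ≠ [] ∨ v ≠ [] → w ≠ []) := by
  induction u, v using shuffles.induct with
  | case1 v => simp [shuffles, hv]
  | case2 a u => simp [shuffles, hu]
  | case3 a u b v ih1 ih2 =>
    intro w hw
    rw [shuffles, Multiset.mem_add, Multiset.mem_map, Multiset.mem_map] at hw
    rcases hw with ⟨z, hz, rfl⟩ | ⟨z, hz, rfl⟩
    · have := ih1 hu.tail hv z hz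
      exact ⟨endsInY_cons this.1 (this.2 (by simp)), by simp⟩
    · have := ih2 hu hv.tail z hz
      exact ⟨endsInY_cons this.1 (this.2 (by simp)), by simp⟩

/-- The shuffle product formula for multiple polylogarithms. -/
theorem polylog_mul_polylog (u v : List Bool) (hu : EndsInY u) (hv : EndsInY v) :
    ((shuffles u v).map polylog).sum = polylog u * polylog v := by
  induction u, v using shuffles.induct with
  | case1 v => simp [shuffles, polylog]
  | case2 a u => simp [shuffles, polylog]
  | case3 a u b v ih1 ih2 =>
    have h1 : ∀ w ∈ shuffles u (b :: v), EndsInY (a :: w) := fun w hw => by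
      have := endsInY_and_ne_nil_of_mem_shuffles u (b :: v) hu.tail hv w hw
      exact endsInY_cons this.1 (this.2 (by simp))
    have h2 : ∀ w ∈ shuffles (a :: u) v, EndsInY (b :: w) := fun w hw => by
      have := endsInY_and_ne_nil_of_mem_shuffles (a :: u) v hu hv.tail w hw
      exact endsInY_cons this.1 (this.2 (by simp))
    rw [shuffles, Multiset.map_add, Multiset.sum_add]
    apply eq_of_X_mul_derivative_eq
    · rw [map_add, mul_add, X_mul_derivative_polylog_sum a _ h1,
        X_mul_derivative_polylog_sum b _ h2, ih1 hu.tail hv, ih2 hu hv.tail,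
        Derivation.leibniz, smul_eq_mul, smul_eq_mul]
      linear_combination (-polylog (b :: v)) * X_mul_derivative_polylog hu -
        polylog (a :: u) * X_mul_derivative_polylog hv
    · rw [map_add, coeff_zero_polylog_sum, coeff_zero_polylog_sum, coeff_mul]
      simp [coeff_zero_polylog_cons, -coeff_zero_eq_constantCoeff]

theorem sum_range_coeff_mul (f g : ℚ⟦X⟧) (M : ℕ) :
    ∑ n ∈ range M, coeff n (f * g) =
      ∑ j ∈ range M, coeff j g * ∑ i ∈ range (M - j), coeff i f := by
  simp_rw [mul_comm f g, coeff_mul, Nat.sum_antidiagonal_eq_sum_range_succ_mk, mul_sum]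
  rw [sum_comm' (t' := range M) (s' := fun j => Ico j M)
    (by intro n j; simp only [mem_range, mem_Ico]; omega)]
  refine sum_congr rfl fun j _ => ?_
  rw [sum_Ico_eq_sum_range]
  simp

theorem coeff_polylogKernel_true_mul (f : ℚ⟦X⟧) (n : ℕ) :
    coeff n (polylogKernel true * f) = ∑ i ∈ range n, coeff i f := by
  cases n with
  | zero => simp [polylogKernel, mul_assoc]
  | succ n =>
    rw [polylogKernel, mul_assoc, coeff_succ_X_mul, mul_comm, coeff_mul,
      Nat.sum_antidiagonal_eq_sum_range_succ_mk]
    simp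

theorem ZAux_append_singleton (ks : List ℕ) (k N a : ℕ) (ha : 1 ≤ a) :
    ZAux N (ks ++ [k]) a = ∑ n ∈ Icc a N, ((n : ℚ) ^ k)⁻¹ * ZAux (n - 1) ks a := by
  induction ks generalizing a with
  | nil => simp [ZAux]
  | cons k₀ ks ih =>
    simp only [List.cons_append, ZAux, mul_sum]
    rw [sum_congr rfl fun n _ => by rw [ih (n + 1) (by omega), mul_sum]]
    rw [sum_comm' (t' := Icc a N) (s' := fun n => Icc a (n - 1))
      (by intro x y; simp only [mem_Icc]; omega)]
    exact sum_congr rfl fun _ _ => sum_congr rfl fun _ _ => by ring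

theorem sum_coeff_polylog (w : List Bool) (c N : ℕ) (hw : EndsInY w) (hc : w ≠ [] ∨ c = 0) :
    ∑ n ∈ range (N + 1), ((n : ℚ) ^ c)⁻¹ * coeff n (polylog w) =
      ZAux N (fromWordAux w c).reverse 1 := by
  induction w generalizing c N with
  | nil =>
    obtain rfl : c = 0 := by simpa using hc
    simp [polylog, fromWordAux, ZAux, coeff_one]
  | cons b w ih =>
    cases b with
    | false =>
      have hne : w ≠ [] := by rintro rfl; simp [EndsInY] at hw
      rw [fromWordAux, ← ih (c + 1) N hw.tail (Or.inl hne)]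
      refine sum_congr rfl fun n _ => ?_
      simp only [polylog, polylogKernel, coeff_mk, one_mul, pow_succ, mul_inv]
      ring
    | true =>
      rw [fromWordAux, List.reverse_cons, ZAux_append_singleton _ _ _ _ le_rfl,
        sum_range_succ', coeff_zero_polylog_cons, mul_zero, add_zero,
        show Icc 1 N = Ico 1 (N + 1) by ext; simp only [mem_Icc, mem_Ico]; omega, sum_Ico_eq_sum_range]
      refine sum_congr rfl fun i _ => ?_
      have hi := ih 0 i hw.tail (Or.inr rfl)
      simp only [pow_zero, inv_one, one_mul] at hi
      rw [polylog, coeff_mk, coeff_polylogKernel_true_mul, hi, add_comm 1 i,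
        Nat.add_sub_cancel, pow_succ, mul_inv]
      ring

theorem endsInY_append_true (w : List Bool) : EndsInY (w ++ [true]) := by
  induction w with
  | nil => rfl
  | cons b w ih => exact endsInY_cons ih (by simp)

theorem endsInY_toWord (ks : List ℕ) : EndsInY (toWord ks) := by
  cases ks with
  | nil => trivial
  | cons k ks =>
    have : toWord (k :: ks) = (toWord ks ++ List.replicate (k - 1) false) ++ [true] := by
      simp [toWord]
    exact this ▸ endsInY_append_true _

theorem toWord_replicate_two_succ (l : ℕ) :
    toWord (List.replicate (l + 1) 2) = false :: true :: toWord (List.replicate l 2) := by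
  rw [toWord, toWord, List.reverse_replicate, List.reverse_replicate]
  simp [List.replicate_succ]

theorem fromWord_toWord_replicate_two (l : ℕ) :
    fromWord (toWord (List.replicate l 2)) = List.replicate l 2 := by
  induction l with
  | zero => rfl
  | succ l ih =>
    rw [toWord_replicate_two_succ, fromWord, fromWordAux, fromWordAux, List.reverse_cons,
      List.replicate_succ']
    exact congrArg (· ++ [2]) ih

theorem sum_range_coeff_polylog (w : List Bool) (N : ℕ) (hw : EndsInY w) :
    ∑ n ∈ range (N + 1), coeff n (polylog w) = ZAux N (fromWord w) 1 := by
  simpa [fromWord] using sum_coeff_polylog w 0 N hw (Or.inr rfl)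

theorem ZR_add (p : ℕ) (v w : List ℕ →₀ ℚ) : ZR p (v + w) = ZR p v + ZR p w :=
  Finsupp.sum_add_index' (by simp) (by intros; ring)

theorem ZR_sum_single {α : Type*} (p : ℕ) (f : α → List ℕ) (s : Multiset α) :
    ZR p ((s.map fun w => Finsupp.single (f w) (1 : ℚ)).sum) = (s.map fun w => Z p (f w)).sum := by
  induction s using Multiset.induction with
  | empty => simp [ZR]
  | cons w s ih =>
    rw [Multiset.map_cons, Multiset.sum_cons, ZR_add, ih, Multiset.map_cons, Multiset.sum_cons]
    simp [ZR]

/-- The shuffle relation for truncated multiple zeta values, before reflecting the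
second index at `p`. -/
theorem ZR_shW (p : ℕ) (hp : 1 ≤ p) (k l : List ℕ) :
    ZR p (shW k l) = ∑ j ∈ range p, coeff j (polylog (toWord l)) *
      ∑ i ∈ range (p - j), coeff i (polylog (toWord k)) := by
  have hk := endsInY_toWord k
  have hl := endsInY_toWord l
  obtain ⟨N, rfl⟩ : ∃ N, p = N + 1 := ⟨p - 1, by omega⟩
  rw [shW, ZR_sum_single, ← sum_range_coeff_mul, ← polylog_mul_polylog _ _ hk hl]
  have hs := fun w hw => (endsInY_and_ne_nil_of_mem_shuffles _ _ hk hl w hw).1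
  generalize shuffles (toWord k) (toWord l) = s at hs
  induction s using Multiset.induction with
  | empty => simp
  | cons w s ih =>
    simp only [Multiset.map_cons, Multiset.sum_cons, map_add, sum_add_distrib]
    rw [ih fun v hv => hs v (by simp [hv]), sum_range_coeff_polylog _ _ (hs w (by simp))]
    rfl

/-- One summation step with weight `1 / (p - n)²`. -/
def reflectSum (p : ℕ) (A : ℕ → ℚ) (M : ℕ) : ℚ :=
  ∑ n ∈ Icc 1 M, (((p : ℚ) - n) ^ 2)⁻¹ * A (n - 1)

theorem coeff_polylog_toWord_replicate_two_succ (l n : ℕ) :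
    coeff n (polylog (toWord (List.replicate (l + 1) 2))) =
      ((n : ℚ) ^ 2)⁻¹ * ∑ i ∈ range n, coeff i (polylog (toWord (List.replicate l 2))) := by
  rw [toWord_replicate_two_succ, polylog, coeff_mk, polylogKernel, one_mul, polylog, coeff_mk,
    coeff_polylogKernel_true_mul, pow_two, mul_inv]
  ring

theorem sum_coeff_polylog_mul_eq_iterate (p : ℕ) (hp : 1 ≤ p) (l : ℕ) (A : ℕ → ℚ) :
    ∑ j ∈ range p, coeff j (polylog (toWord (List.replicate l 2))) * A (p - 1 - j) =
      (reflectSum p)^[l] A (p - 1) := by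
  induction l generalizing A with
  | zero => simp [toWord, polylog, coeff_one, show 0 < p from hp]
  | succ l ih =>
    rw [Function.iterate_succ_apply, ← ih]
    simp_rw [coeff_polylog_toWord_replicate_two_succ, mul_sum, sum_mul]
    rw [sum_comm' (t' := range p) (s' := fun i => Ico (i + 1) p)
      (by intro n j; simp only [mem_range, mem_Ico]; omega)]
    refine sum_congr rfl fun i _ => ?_
    rw [reflectSum, mul_sum]
    refine sum_bij' (fun j _ => p - j) (fun n _ => p - n) ?_ ?_ ?_ ?_ ?_
    · intro j hj; simp only [mem_Ico, mem_Icc] at *; omega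
    · intro j hj; simp only [mem_Ico, mem_Icc] at *; omega
    · intro j hj; simp only [mem_Ico] at *; omega
    · intro j hj; simp only [mem_Icc] at *; omega
    · intro j hj
      simp only [mem_Ico] at hj
      rw [Nat.cast_sub hj.2.le, show p - 1 - j = p - j - 1 by omega]
      ring

end ShuffleSeries

section ModSquare

open Finset

variable {p : ℕ} [Fact p.Prime]

theorem padicNorm_sum_le_of_forall_le {ι : Type*} (s : Finset ι) (f : ι → ℚ) {t : ℚ} (ht : 0 ≤ t)
    (h : ∀ i ∈ s, padicNorm p (f i) ≤ t) : padicNorm p (∑ i ∈ s, f i) ≤ t :=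
  padicNorm.sum_le' h ht

theorem padicNorm_mul_le_one {a b : ℚ} (ha : padicNorm p a ≤ 1) (hb : padicNorm p b ≤ 1) :
    padicNorm p (a * b) ≤ 1 := by
  rw [padicNorm.mul]
  exact mul_le_one₀ ha (padicNorm.nonneg _) hb

theorem padicNorm_add_le {a b t : ℚ} (ha : padicNorm p a ≤ t) (hb : padicNorm p b ≤ t) :
    padicNorm p (a + b) ≤ t :=
  padicNorm.nonarchimedean.trans (max_le ha hb)

theorem padicNorm_prime_sq_mul_le {a : ℚ} (ha : padicNorm p a ≤ 1) :
    padicNorm p ((p : ℚ) ^ 2 * a) ≤ (p : ℚ) ^ (-((2 : ℕ) : ℤ)) := by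
  have hp : padicNorm p ((p : ℚ) ^ 2) = (p : ℚ) ^ (-((2 : ℕ) : ℤ)) := by
    rw [pow_two, padicNorm.mul, padicNorm.padicNorm_p_of_prime]
    simp [pow_two]
  rw [padicNorm.mul, hp]
  exact mul_le_of_le_one_right (by positivity) ha

theorem padicNorm_mul_le {a b t : ℚ} (ha : padicNorm p a ≤ 1) (hb : padicNorm p b ≤ t) :
    padicNorm p (a * b) ≤ t := by
  rw [padicNorm.mul]
  exact (mul_le_of_le_one_left (padicNorm.nonneg _) ha).trans hb

theorem padicNorm_inv_natCast {n : ℕ} (h0 : 1 ≤ n) (hn : n < p) : padicNorm p (n : ℚ)⁻¹ = 1 := by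
  have : padicNorm p (n : ℚ) = 1 :=
    (padicNorm.nat_eq_one_iff n).2 (Nat.not_dvd_of_pos_of_lt h0 hn)
  rw [← one_div, padicNorm.div, this]
  simp

theorem padicNorm_pow_le_one {a : ℚ} (ha : padicNorm p a ≤ 1) (k : ℕ) :
    padicNorm p (a ^ k) ≤ 1 := by
  induction k with
  | zero => simp
  | succ k ih => exact pow_succ a k ▸ padicNorm_mul_le_one ih ha

theorem padicNorm_ZAux_le_one (N : ℕ) (hN : N < p) (ks : List ℕ) (a : ℕ) (ha : 1 ≤ a) :
    padicNorm p (ZAux N ks a) ≤ 1 := by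
  induction ks generalizing a with
  | nil => simp [ZAux]
  | cons k ks ih =>
    refine padicNorm_sum_le_of_forall_le _ _ zero_le_one fun n hn => ?_
    rw [mem_Icc] at hn
    refine padicNorm_mul_le_one ?_ (ih (n + 1) (by omega))
    rw [← inv_pow]
    exact padicNorm_pow_le_one (padicNorm_inv_natCast (by omega) (by omega)).le k

/-- The main term of the `l`-fold reflected sum modulo `p²`. -/
def reflectExpansion (p a l M : ℕ) : ℚ :=
  ZAux M (List.replicate (a + l) 2) 1 +
    2 * p * ∑ j ∈ range l, ZAux M (List.replicate (a + j) 2 ++ 3 :: List.replicate (l - j - 1) 2) 1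

theorem reflectExpansion_succ (p a l M : ℕ) :
    reflectExpansion p a (l + 1) M = ∑ n ∈ Icc 1 M,
      (((n : ℚ) ^ 2)⁻¹ * reflectExpansion p a l (n - 1) +
        2 * p * (((n : ℚ) ^ 3)⁻¹ * ZAux (n - 1) (List.replicate (a + l) 2) 1)) := by
  have h : ∀ j ∈ range l,
      ZAux M (List.replicate (a + j) 2 ++ 3 :: List.replicate (l + 1 - j - 1) 2) 1 =
        ∑ n ∈ Icc 1 M, ((n : ℚ) ^ 2)⁻¹ *
          ZAux (n - 1) (List.replicate (a + j) 2 ++ 3 :: List.replicate (l - j - 1) 2) 1 := by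
    intro j hj
    rw [mem_range] at hj
    rw [← ZAux_append_singleton _ _ _ _ le_rfl, show l + 1 - j - 1 = l - j - 1 + 1 by omega,
      List.replicate_succ']
    simp
  rw [reflectExpansion, sum_range_succ, sum_congr rfl h, sum_comm, ← add_assoc a l 1,
    List.replicate_succ', ZAux_append_singleton _ _ _ _ le_rfl]
  simp only [Nat.add_sub_cancel_left, Nat.sub_self, List.replicate_zero]
  rw [ZAux_append_singleton _ _ _ _ le_rfl, ← sum_add_distrib, mul_sum, ← sum_add_distrib]
  refine sum_congr rfl fun n _ => ?_
  rw [reflectExpansion, ← mul_sum]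
  ring

theorem iterate_reflectSum_congr (a l M : ℕ) (hM : M < p) :
    padicNorm p ((reflectSum p)^[l] (fun N => ZAux N (List.replicate a 2) 1) M -
      reflectExpansion p a l M) ≤ (p : ℚ) ^ (-((2 : ℕ) : ℤ)) := by
  induction l generalizing M with
  | zero =>
    simp only [Function.iterate_zero, id_eq, reflectExpansion, add_zero, range_zero, sum_empty,
      mul_zero, sub_self, padicNorm.zero]
    positivity
  | succ l ih =>
    rw [Function.iterate_succ_apply', reflectSum, reflectExpansion_succ, ← sum_sub_distrib]
    refine padicNorm_sum_le_of_forall_le _ _ (by positivity) fun n hn => ?_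
    rw [mem_Icc] at hn
    have ihn := ih (n - 1) (by omega)
    set B := (reflectSum p)^[l] (fun N => ZAux N (List.replicate a 2) 1) (n - 1)
    have hu := padicNorm_inv_natCast (p := p) (n := n) (by omega) (by omega)
    have hv := padicNorm_inv_natCast (p := p) (n := p - n) (by omega) (by omega)
    rw [Nat.cast_sub (by omega)] at hv
    have hn0 : (n : ℚ) ≠ 0 := by
      have : n ≠ 0 := by omega
      exact_mod_cast this
    have hpn0 : (p : ℚ) - n ≠ 0 := by
      rw [sub_ne_zero]
      have : p ≠ n := by omega
      exact_mod_cast this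
    have hZ := padicNorm_ZAux_le_one (p := p) (n - 1) (by omega) (List.replicate (a + l) 2) 1 le_rfl
    set T := ∑ j ∈ range l,
      ZAux (n - 1) (List.replicate (a + j) 2 ++ 3 :: List.replicate (l - j - 1) 2) 1 with hT
    have hT1 : padicNorm p T ≤ 1 := padicNorm_sum_le_of_forall_le _ _ zero_le_one fun j _ =>
      padicNorm_ZAux_le_one _ (by omega) _ 1 le_rfl
    have hE : reflectExpansion p a l (n - 1) =
      ZAux (n - 1) (List.replicate (a + l) 2) 1 + 2 * p * T := rfl
    have key : (((p : ℚ) - n) ^ 2)⁻¹ * B - (((n : ℚ) ^ 2)⁻¹ * reflectExpansion p a l (n - 1) +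
        2 * p * (((n : ℚ) ^ 3)⁻¹ * ZAux (n - 1) (List.replicate (a + l) 2) 1)) =
        ((p : ℚ) - n)⁻¹ ^ 2 * (B - reflectExpansion p a l (n - 1)) +
        (p : ℚ) ^ 2 * (((3 * n - 2 * p : ℤ) : ℚ) * ((p : ℚ) - n)⁻¹ ^ 2 * (n : ℚ)⁻¹ ^ 3 *
            ZAux (n - 1) (List.replicate (a + l) 2) 1 +
          ((2 * (2 * n - p) : ℤ) : ℚ) * ((p : ℚ) - n)⁻¹ ^ 2 * (n : ℚ)⁻¹ ^ 2 * T) := by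
      rw [hE]
      push_cast
      field_simp
      ring
    rw [key]
    have hu' := padicNorm_pow_le_one hu.le
    have hv' := padicNorm_pow_le_one hv.le
    exact padicNorm_add_le (padicNorm_mul_le (hv' 2) ihn) <| padicNorm_prime_sq_mul_le <|
      padicNorm_add_le
        (padicNorm_mul_le_one (padicNorm_mul_le_one (padicNorm_mul_le_one
          (padicNorm.of_int _) (hv' 2)) (hu' 3)) hZ)
        (padicNorm_mul_le_one (padicNorm_mul_le_one (padicNorm_mul_le_one
          (padicNorm.of_int _) (hv' 2)) (hu' 2)) hT1)

end ModSquare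

/-- Expansion of `Z_p(({2}^{l+m}) ш ({2}^l))` modulo `p²` via the shuffle relation
(first step in the proof of Lemma 5 of Murahara–Onozuka–Seki). -/
theorem stmt16 (l m : ℕ) (h : (l, m) ≠ (0, 0)) :
    ∀ᶠ p in Filter.cofinite, p.Prime →
      congrMod p 2
        (ZR p (shW (List.replicate (l + m) 2) (List.replicate l 2)))
        (Z p (List.replicate (2 * l + m) 2) +
          2 * p * ∑ j ∈ Finset.range l,
            Z p (List.replicate (l + m + j) 2 ++ 3 :: List.replicate (l - j - 1) 2)) := by
  refine Filter.Eventually.of_forall fun p hp => ?_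
  have : Fact p.Prime := ⟨hp⟩
  have hA : ZR p (shW (List.replicate (l + m) 2) (List.replicate l 2)) =
      (reflectSum p)^[l] (fun N => ZAux N (List.replicate (l + m) 2) 1) (p - 1) := by
    rw [ZR_shW p hp.one_le, ← sum_coeff_polylog_mul_eq_iterate p hp.one_le]
    refine Finset.sum_congr rfl fun j hj => ?_
    rw [Finset.mem_range] at hj
    rw [show p - j = p - 1 - j + 1 by omega, sum_range_coeff_polylog _ _ (endsInY_toWord _),
      fromWord_toWord_replicate_two]
  rw [congrMod, hA]
  have := iterate_reflectSum_congr (p := p) (l + m) l (p - 1) (by have := hp.one_le; omega)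
  rwa [reflectExpansion, show l + m + l = 2 * l + m by omega] at this
end
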